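/- arXiv:2306.08065 — 3 statements merged into one kernel-verified Lean document; each statement's English description precedes it below -/
import Mathlib

section
/- For every integer n ≥ 0 and every set T ⊆ [n], the number of permutations in Av_n(132) with descent top set T, the number of permutations in Av_n(231) with descent top set T, and the number of permutations in Av_n(312) with descent top set T are all equal. (Equivalently, the patterns 132, 231, 312 are Destop-Wilf equivalent.) -/
open scoped Classical

/-- The 1-based `i`-th entry of a permutation `σ` of `{1,…,n}`, as a value in `{1,…,n}`
(one-line notation `σ(1)…σ(n)`). -/
def entry {n : ℕ} (σ : Equiv.Perm (Fin n)) (i : ℕ) : ℕ :=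
  if h : i - 1 < n then (σ ⟨i - 1, h⟩ : ℕ) + 1 else 0

/-- `σ` contains the pattern `π ∈ S_k` (given in 0-based one-line notation as a function):
there is a (not necessarily consecutive) subsequence of `σ` order-isomorphic to `π`. -/
def Contains {n k : ℕ} (π : Fin k → Fin k) (σ : Equiv.Perm (Fin n)) : Prop :=
  ∃ f : Fin k → Fin n, StrictMono f ∧ ∀ i j : Fin k, π i < π j ↔ σ (f i) < σ (f j)

/-- `σ` avoids the pattern `π`. -/
def AvoidsPat {n k : ℕ} (π : Fin k → Fin k) (σ : Equiv.Perm (Fin n)) : Prop :=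
  ¬ Contains π σ

/-- The descent set of `σ` (1-based positions `i ∈ [n-1]` with `σ(i) > σ(i+1)`). -/
def Des {n : ℕ} (σ : Equiv.Perm (Fin n)) : Finset ℕ :=
  (Finset.Icc 1 (n - 1)).filter (fun i => entry σ (i + 1) < entry σ i)

/-- The descent top set of `σ`: `{σ(i) : i ∈ Des σ}`. -/
def Destop {n : ℕ} (σ : Equiv.Perm (Fin n)) : Finset ℕ :=
  (Des σ).image (entry σ)

/-- The descent bottom set of `σ`: `{σ(i+1) : i ∈ Des σ}`. -/
def Desbot {n : ℕ} (σ : Equiv.Perm (Fin n)) : Finset ℕ :=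
  (Des σ).image (fun i => entry σ (i + 1))

/-- The ascent set of `σ` (1-based positions `i ∈ [n-1]` with `σ(i) < σ(i+1)`). -/
def Asc {n : ℕ} (σ : Equiv.Perm (Fin n)) : Finset ℕ :=
  (Finset.Icc 1 (n - 1)).filter (fun i => entry σ i < entry σ (i + 1))

/-- The ascent top set of `σ`: `{σ(i+1) : i ∈ Asc σ}`. -/
def Asctop {n : ℕ} (σ : Equiv.Perm (Fin n)) : Finset ℕ :=
  (Asc σ).image (fun i => entry σ (i + 1))

/-- The ascent bottom set of `σ`: `{σ(i) : i ∈ Asc σ}`. -/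
def Ascbot {n : ℕ} (σ : Equiv.Perm (Fin n)) : Finset ℕ :=
  (Asc σ).image (entry σ)

/-- The set of peak values of `σ`. -/
def Peak {n : ℕ} (σ : Equiv.Perm (Fin n)) : Finset ℕ :=
  Destop σ ∩ Asctop σ

/-- The set of valley values of `σ`. -/
def Val {n : ℕ} (σ : Equiv.Perm (Fin n)) : Finset ℕ :=
  Desbot σ ∩ Ascbot σ

/-- The set of left-to-right maxima (as values) of `σ`. -/
noncomputable def LRmax {n : ℕ} (σ : Equiv.Perm (Fin n)) : Finset ℕ :=
  ((Finset.Icc 1 n).filter (fun i => ∀ j, 1 ≤ j → j < i → entry σ j < entry σ i)).image (entry σ)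

/-- The set of left-to-right minima (as values) of `σ`. -/
noncomputable def LRmin {n : ℕ} (σ : Equiv.Perm (Fin n)) : Finset ℕ :=
  ((Finset.Icc 1 n).filter (fun i => ∀ j, 1 ≤ j → j < i → entry σ i < entry σ j)).image (entry σ)

/-- The set of right-to-left maxima (as values) of `σ`. -/
noncomputable def RLmax {n : ℕ} (σ : Equiv.Perm (Fin n)) : Finset ℕ :=
  ((Finset.Icc 1 n).filter (fun i => ∀ j, i < j → j ≤ n → entry σ j < entry σ i)).image (entry σ)

/-- The set of right-to-left minima (as values) of `σ`. -/
noncomputable def RLmin {n : ℕ} (σ : Equiv.Perm (Fin n)) : Finset ℕ :=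
  ((Finset.Icc 1 n).filter (fun i => ∀ j, i < j → j ≤ n → entry σ i < entry σ j)).image (entry σ)

/-- `(T, B)` is a descent matching: `T` and `B` are finite sets of positive integers
with `|T| = |B| = k`, and writing `T = {t_1 < … < t_k}`, `B = {b_1 < … < b_k}`,
we have `t_i > b_i` for all `i ∈ [k]`. -/
def DescentMatching (T B : Finset ℕ) : Prop :=
  T.card = B.card ∧ (∀ t ∈ T, 0 < t) ∧ (∀ b ∈ B, 0 < b) ∧
    ∀ i < T.card, (B.sort (· ≤ ·)).getD i 0 < (T.sort (· ≤ ·)).getD i 0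

/-- `(2_v 31)σ`: the number of occurrences of the vincular pattern `2-31` in `σ`
in which the "2" has value `v`. -/
def occ2_31at {n : ℕ} (σ : Equiv.Perm (Fin n)) (v : ℕ) : ℕ :=
  ((Finset.Icc 1 (n - 1) ×ˢ Finset.Icc 1 (n - 1)).filter
    (fun p => p.1 < p.2 ∧ entry σ (p.2 + 1) < entry σ p.2 ∧
      entry σ (p.2 + 1) < entry σ p.1 ∧ entry σ p.1 = v ∧ v < entry σ p.2)).card

/-- `(31 2_v)σ`: the number of occurrences of the vincular pattern `31-2` in `σ`
in which the "2" has value `v`. -/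
def occ31_2at {n : ℕ} (σ : Equiv.Perm (Fin n)) (v : ℕ) : ℕ :=
  ((Finset.Icc 1 (n - 1) ×ˢ Finset.Icc 1 n).filter
    (fun p => p.1 + 1 < p.2 ∧ entry σ (p.1 + 1) < entry σ p.1 ∧
      entry σ (p.1 + 1) < entry σ p.2 ∧ entry σ p.2 = v ∧ v < entry σ p.1)).card

/-- `(2-31)σ`: the number of occurrences of the vincular pattern `2-31` in `σ`. -/
def occ2_31 {n : ℕ} (σ : Equiv.Perm (Fin n)) : ℕ :=
  ((Finset.Icc 1 (n - 1) ×ˢ Finset.Icc 1 (n - 1)).filter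
    (fun p => p.1 < p.2 ∧ entry σ (p.2 + 1) < entry σ p.2 ∧
      entry σ (p.2 + 1) < entry σ p.1 ∧ entry σ p.1 < entry σ p.2)).card

/-- `(31-2)σ`: the number of occurrences of the vincular pattern `31-2` in `σ`. -/
def occ31_2 {n : ℕ} (σ : Equiv.Perm (Fin n)) : ℕ :=
  ((Finset.Icc 1 (n - 1) ×ˢ Finset.Icc 1 n).filter
    (fun p => p.1 + 1 < p.2 ∧ entry σ (p.1 + 1) < entry σ p.1 ∧
      entry σ (p.1 + 1) < entry σ p.2 ∧ entry σ p.2 < entry σ p.1)).card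

/-- The signature function `sg_{(T,B)}(i) = |B_{<i}| - |T_{≤i}| + 1`. -/
def sg (T B : Finset ℕ) (i : ℕ) : ℕ :=
  (B.filter (fun b => b < i)).card - (T.filter (fun t => t ≤ i)).card + 1

/-- The `(p,q)`-integer `[m]_{p,q} = Σ_{a+b=m-1} p^a q^b`. -/
def genQInt {R : Type*} [CommRing R] (m : ℕ) (p q : R) : R :=
  ∑ a ∈ Finset.range m, p ^ a * q ^ (m - 1 - a)

/-- The reverse complement of `σ`: `σ^{rc}(i) = n + 1 - σ(n + 1 - i)`. -/
def revComp {n : ℕ} (σ : Equiv.Perm (Fin n)) : Equiv.Perm (Fin n) :=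
  (Fin.revPerm.trans σ).trans Fin.revPerm

namespace DW

/-- The weight of a list: the product of `x t` over descent tops `t`. -/
def wt {R : Type*} [CommRing R] (x : ℕ → R) : List ℕ → R
  | [] => 1
  | [_] => 1
  | a :: b :: l => (if b < a then x a else 1) * wt x (b :: l)

/-- The weight of a list where the last entry counts as a descent top too. -/
def ws {R : Type*} [CommRing R] (x : ℕ → R) : List ℕ → R
  | [] => 1
  | [a] => x a
  | a :: b :: l => (if b < a then x a else 1) * ws x (b :: l)

/-- Arrangements of `Ico a b` all of whose triples satisfy `p`. -/
noncomputable def W (p : ℕ → ℕ → ℕ → Prop) (a b : ℕ) : Finset (List ℕ) :=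
  ((Finset.Ico a b).val.lists.toFinset).filter (fun l => l.Triplewise p)

lemma mem_W {p : ℕ → ℕ → ℕ → Prop} {a b : ℕ} {l : List ℕ} :
    l ∈ W p a b ↔ (l.Nodup ∧ ∀ x, x ∈ l ↔ a ≤ x ∧ x < b) ∧ l.Triplewise p := by
  unfold W
  rw [Finset.mem_filter, Multiset.mem_toFinset, Multiset.mem_lists_iff]
  refine and_congr_left fun _ => ?_
  constructor
  · intro h
    refine ⟨?_, fun x => ?_⟩
    · have := (Finset.Ico a b).nodup
      rw [h] at this
      exact this
    · rw [← Finset.mem_Ico, ← Finset.mem_val, h]; rfl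
  · rintro ⟨h1, h2⟩
    refine (Multiset.Nodup.ext (Finset.nodup _) (Multiset.coe_nodup.2 h1)).2 fun x => ?_
    rw [Finset.mem_val, Finset.mem_Ico]
    exact (h2 x).symm

/-- pattern conditions -/
def p231 (x y z : ℕ) : Prop := ¬ (z < x ∧ x < y)
def p132 (x y z : ℕ) : Prop := ¬ (x < z ∧ z < y)
def p312 (x y z : ℕ) : Prop := ¬ (y < z ∧ z < x)

lemma length_of_W {p : ℕ → ℕ → ℕ → Prop} {a b : ℕ} {l : List ℕ} (h : l ∈ W p a b) :
    l.length = b - a := by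
  obtain ⟨⟨h1, h2⟩, -⟩ := mem_W.1 h
  rw [← List.toFinset_card_of_nodup h1, ← Nat.card_Ico]
  congr 1
  ext x
  simp [h2]

lemma W_self (p : ℕ → ℕ → ℕ → Prop) (a : ℕ) : W p a a = {[]} := by
  ext l
  rw [mem_W, Finset.mem_singleton]
  constructor
  · rintro ⟨⟨_, h⟩, -⟩
    rw [List.eq_nil_iff_forall_not_mem]
    intro x hx
    have := (h x).1 hx
    omega
  · rintro rfl
    refine ⟨⟨by simp, fun x => ?_⟩, by simp⟩
    simp

lemma split_interval (A B : List ℕ) (a b : ℕ) (hab : a ≤ b)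
    (h : ∀ x, (x ∈ A ∨ x ∈ B) ↔ a ≤ x ∧ x < b) (hlt : ∀ x ∈ A, ∀ y ∈ B, x < y) :
    ∃ c, a ≤ c ∧ c ≤ b ∧ (∀ x, x ∈ A ↔ a ≤ x ∧ x < c) ∧ (∀ x, x ∈ B ↔ c ≤ x ∧ x < b) := by
  by_cases hB : ∃ y, y ∈ B
  · have hs := Nat.find_spec hB
    have hm : ∀ y ∈ B, Nat.find hB ≤ y := fun y hy => Nat.find_min' hB hy
    set c := Nat.find hB
    have hc := (h c).1 (Or.inr hs)
    refine ⟨c, hc.1, hc.2.le, fun x => ⟨fun hx => ?_, fun hx => ?_⟩,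
      fun x => ⟨fun hx => ?_, fun hx => ?_⟩⟩
    · exact ⟨((h x).1 (Or.inl hx)).1, hlt x hx c hs⟩
    · rcases (h x).2 ⟨hx.1, by omega⟩ with h' | h'
      · exact h'
      · have := hm x h'; omega
    · exact ⟨hm x hx, ((h x).1 (Or.inr hx)).2⟩
    · rcases (h x).2 ⟨by omega, hx.2⟩ with h' | h'
      · have := hlt x h' c hs; omega
      · exact h'
  · push Not at hB
    refine ⟨b, hab, le_rfl, fun x => ?_, fun x => ?_⟩
    · rw [← h x]; simp [hB x]
    · simp [hB x]

section weights
variable {R : Type*} [CommRing R] (x : ℕ → R)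

lemma wt_append_lt (L M : List ℕ) (b : ℕ) (h : ∀ y ∈ L, y < b) :
    wt x (L ++ b :: M) = wt x L * wt x (b :: M) := by
  induction L with
  | nil => simp [wt]
  | cons u L ih =>
    have ih := ih (fun y hy => h y (List.mem_cons_of_mem _ hy))
    cases L with
    | nil =>
      have := h u (by simp)
      simp [wt, this.not_gt]
    | cons v L =>
      simp only [List.cons_append, wt] at ih ⊢
      rw [ih, mul_assoc]

lemma ws_append_lt (L M : List ℕ) (b : ℕ) (h : ∀ y ∈ L, y < b) :
    ws x (L ++ b :: M) = wt x L * ws x (b :: M) := by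
  induction L with
  | nil => simp [wt]
  | cons u L ih =>
    have ih := ih (fun y hy => h y (List.mem_cons_of_mem _ hy))
    cases L with
    | nil =>
      have := h u (by simp)
      simp [wt, ws, this.not_gt]
    | cons v L =>
      simp only [List.cons_append, wt, ws] at ih ⊢
      rw [ih, mul_assoc]

lemma wt_append_gt (L : List ℕ) (b : ℕ) (h : ∀ y ∈ L, b < y) :
    wt x (L ++ [b]) = ws x L := by
  induction L with
  | nil => simp [wt, ws]
  | cons u L ih =>
    have ih := ih (fun y hy => h y (List.mem_cons_of_mem _ hy))
    cases L with
    | nil =>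
      have := h u (by simp)
      simp [wt, ws, this]
    | cons v L =>
      simp only [List.cons_append, wt, ws] at ih ⊢
      rw [ih]

lemma ws_append_gt (L : List ℕ) (b : ℕ) (h : ∀ y ∈ L, b < y) :
    ws x (L ++ [b]) = ws x L * x b := by
  induction L with
  | nil => simp [ws]
  | cons u L ih =>
    have ih := ih (fun y hy => h y (List.mem_cons_of_mem _ hy))
    cases L with
    | nil =>
      have := h u (by simp)
      simp [ws, this]
    | cons v L =>
      simp only [List.cons_append, ws] at ih ⊢
      rw [ih, mul_assoc]

lemma wt_cons_gt (L : List ℕ) (b : ℕ) (h : ∀ y ∈ L, y < b) :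
    wt x (b :: L) = (if L = [] then 1 else x b) * wt x L := by
  cases L with
  | nil => simp [wt]
  | cons v L =>
    have := h v (by simp)
    simp [wt, this]

lemma append_lt_wt (S B : List ℕ) (h : ∀ y ∈ S, ∀ z ∈ B, y < z) :
    wt x (S ++ B) = wt x S * wt x B := by
  cases B with
  | nil => simp [wt]
  | cons b B => exact wt_append_lt x S B b (fun y hy => h y hy b (by simp))

lemma append_lt_ws (S B : List ℕ) (hB : B ≠ []) (h : ∀ y ∈ S, ∀ z ∈ B, y < z) :
    ws x (S ++ B) = wt x S * ws x B := by
  cases B with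
  | nil => exact absurd rfl hB
  | cons b B => exact ws_append_lt x S B b (fun y hy => h y hy b (by simp))

/-- generating functions -/
noncomputable def F (p : ℕ → ℕ → ℕ → Prop) (a b : ℕ) : R := ∑ l ∈ W p a b, wt x l
noncomputable def FS (p : ℕ → ℕ → ℕ → Prop) (a b : ℕ) : R := ∑ l ∈ W p a b, ws x l

lemma F_self (p : ℕ → ℕ → ℕ → Prop) (a : ℕ) : F x p a a = 1 := by simp [F, W_self, wt]
lemma FS_self (p : ℕ → ℕ → ℕ → Prop) (a : ℕ) : FS x p a a = 1 := by simp [FS, W_self, ws]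

lemma triple231 (L M : List ℕ) (b : ℕ) (hL : ∀ y ∈ L, y < b) (hM : ∀ y ∈ M, y < b) 
    (hd : ∀ y ∈ L, y ∉ M) :
    (L ++ b :: M).Triplewise p231 ↔
      (L.Triplewise p231 ∧ M.Triplewise p231) ∧ ∀ y ∈ L, ∀ z ∈ M, y < z := by
  rw [List.triplewise_append, List.triplewise_cons]
  constructor
  · rintro ⟨h1, ⟨h2, h3⟩, h4, h5⟩
    refine ⟨⟨h1, h3⟩, fun y hy z hz => ?_⟩
    have := (List.pairwise_cons.1 (h4 y hy)).1 z hz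
    have h6 := hL y hy
    have h7 : y ≠ z := fun h => hd y hy (h ▸ hz)
    unfold p231 at this
    omega
  · rintro ⟨⟨h1, h2⟩, h3⟩
    refine ⟨h1, ⟨?_, h2⟩, ?_, ?_⟩
    · refine List.pairwise_of_forall_mem_list fun y hy z hz => ?_
      have := hM y hy
      unfold p231; omega
    · intro y hy
      refine List.pairwise_cons.2 ⟨fun z hz => ?_, List.pairwise_of_forall_mem_list fun u hu z hz => ?_⟩
      · have := h3 y hy z hz
        unfold p231; omega
      · have := h3 y hy z hz
        unfold p231; omega
    · intro z hz
      refine List.pairwise_of_forall_mem_list fun u hu v hv => ?_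
      rcases List.mem_cons.1 hz with rfl | hz
      · have := hL u hu
        unfold p231; omega
      · have := h3 u hu z hz
        unfold p231; omega

lemma triple132 (L M : List ℕ) (b : ℕ) (hL : ∀ y ∈ L, y < b) (hM : ∀ y ∈ M, y < b) 
    (hd : ∀ y ∈ L, y ∉ M) :
    (L ++ b :: M).Triplewise p132 ↔
      (L.Triplewise p132 ∧ M.Triplewise p132) ∧ ∀ y ∈ L, ∀ z ∈ M, z < y := by
  rw [List.triplewise_append, List.triplewise_cons]
  constructor
  · rintro ⟨h1, ⟨h2, h3⟩, h4, h5⟩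
    refine ⟨⟨h1, h3⟩, fun y hy z hz => ?_⟩
    have := (List.pairwise_cons.1 (h4 y hy)).1 z hz
    have h6 := hM z hz
    have h7 : y ≠ z := fun h => hd y hy (h ▸ hz)
    unfold p132 at this
    omega
  · rintro ⟨⟨h1, h2⟩, h3⟩
    refine ⟨h1, ⟨?_, h2⟩, ?_, ?_⟩
    · refine List.pairwise_of_forall_mem_list fun y hy z hz => ?_
      have := hM z hz
      unfold p132; omega
    · intro y hy
      refine List.pairwise_cons.2 ⟨fun z hz => ?_, List.pairwise_of_forall_mem_list fun u hu z hz => ?_⟩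
      · have := h3 y hy z hz
        unfold p132; omega
      · have := h3 y hy z hz
        unfold p132; omega
    · intro z hz
      refine List.pairwise_of_forall_mem_list fun u hu v hv => ?_
      rcases List.mem_cons.1 hz with rfl | hz
      · have := hL v hv
        unfold p132; omega
      · have := h3 u hu z hz
        unfold p132; omega

lemma triple312 (S B : List ℕ) (b : ℕ) (hS : b ∉ S) (hB : b ∉ B) 
    (h1 : ∀ y ∈ S, y < b) (h2 : ∀ y ∈ B, b < y) :
    (S ++ B ++ [b]).Triplewise p312 ↔ (S.Triplewise p312 ∧ B.Triplewise p312) := by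
  rw [List.triplewise_append, List.triplewise_append]
  constructor
  · rintro ⟨⟨h1, h3, -⟩, -⟩
    exact ⟨h1, h3⟩
  · rintro ⟨h3, h4⟩
    refine ⟨⟨h3, h4, ?_, ?_⟩, by simp, by simp, ?_⟩
    · intro y hy
      refine List.pairwise_of_forall_mem_list fun u hu z hz => ?_
      have := h1 y hy
      have := h2 z hz
      unfold p312; omega
    · intro z hz
      refine List.pairwise_of_forall_mem_list fun u hu v hv => ?_
      have := h1 u hu
      have := h2 z hz
      unfold p312; omega
    · intro z hz
      obtain rfl : z = b := by simpa using hz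
      refine List.pairwise_append.2 ⟨?_, ?_, ?_⟩
      · refine List.pairwise_of_forall_mem_list fun u hu v hv => ?_
        have := h1 u hu
        unfold p312; omega
      · refine List.pairwise_of_forall_mem_list fun u hu v hv => ?_
        have := h2 v hv
        unfold p312; omega
      · intro u hu v hv
        have := h1 u hu
        unfold p312; omega

/-- in a list with last entry `b` avoiding 312, the small entries precede the large ones -/
lemma exists_split312 (l : List ℕ) (b : ℕ) (hb : b ∉ l)
    (h : l.Pairwise fun u v => p312 u v b) :
    ∃ S B, l = S ++ B ∧ (∀ y ∈ S, y < b) ∧ (∀ y ∈ B, b < y) := by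
  induction l with
  | nil => exact ⟨[], [], by simp⟩
  | cons u l ih =>
    rw [List.mem_cons, not_or] at hb
    rw [List.pairwise_cons] at h
    obtain ⟨S, B, rfl, h1, h2⟩ := ih hb.2 h.2
    by_cases hu : u < b
    · refine ⟨u :: S, B, rfl, ?_, h2⟩
      intro y hy
      rcases List.mem_cons.1 hy with rfl | hy
      · exact hu
      · exact h1 y hy
    · have hu : b < u := by have := hb.1; omega
      have hS : S = [] := by
        rw [List.eq_nil_iff_forall_not_mem]
        intro y hy
        have := h.1 y (by simp [hy])
        have := h1 y hy
        unfold p312 at *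
        omega
      subst hS
      refine ⟨[], u :: B, rfl, by simp, ?_⟩
      intro y hy
      rcases List.mem_cons.1 hy with rfl | hy
      · exact hu
      · exact h2 y hy

lemma rec231 (a b : ℕ) (hab : a ≤ b) : F x p231 a (b + 1) =
    ∑ c ∈ Finset.Icc a b, F x p231 a c * F x p231 c b * (if c = b then 1 else x b) := by
  simp only [F, Finset.sum_mul_sum]
  simp only [Finset.sum_mul]
  simp only [← Finset.sum_product']
  rw [Finset.sum_sigma']
  symm
  refine Finset.sum_bij (fun q _ => q.2.1 ++ b :: q.2.2) ?_ ?_ ?_ ?_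
  · rintro ⟨c, L, M⟩ hq
    simp only [Finset.mem_sigma, Finset.mem_Icc, Finset.mem_product] at hq
    obtain ⟨⟨hc1, hc2⟩, hL, hM⟩ := hq
    rw [mem_W] at hL hM ⊢
    obtain ⟨⟨l1, l2⟩, l3⟩ := hL
    obtain ⟨⟨m1, m2⟩, m3⟩ := hM
    refine ⟨⟨?_, ?_⟩, (triple231 L M b ?_ ?_ ?_).2 ⟨⟨l3, m3⟩, ?_⟩⟩
    · rw [List.nodup_append, List.nodup_cons]
      refine ⟨l1, ⟨by rw [m2]; omega, m1⟩, ?_⟩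
      intro u hu v hv
      rw [l2] at hu
      rw [List.mem_cons, m2] at hv
      omega
    · intro u
      simp only [List.mem_append, List.mem_cons, l2, m2]
      omega
    · intro y; rw [l2]; omega
    · intro y; rw [m2]; omega
    · intro y; rw [l2, m2]; omega
    · intro y hy z hz; rw [l2] at hy; rw [m2] at hz; omega
  · rintro ⟨c, L, M⟩ hq ⟨c', L', M'⟩ hq' he
    simp only [Finset.mem_sigma, Finset.mem_Icc, Finset.mem_product] at hq hq' he
    obtain ⟨⟨hc1, hc2⟩, hL, hM⟩ := hq
    obtain ⟨⟨hc1', hc2'⟩, hL', hM'⟩ := hq'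
    have e1 := length_of_W hL
    have e2 := length_of_W hL'
    rw [mem_W] at hL hM
    have hLL : L = L' ∧ M = M' := by
      have := (List.append_cons_inj_of_notMem (x₁ := L) (x₂ := L') (z₁ := M) (z₂ := M') (a₁ := b) (a₂ := b)
        (by rw [hL.1.2]; omega) (by rw [hM.1.2]; omega)).1 he
      tauto
    obtain ⟨rfl, rfl⟩ := hLL
    have : c = c' := by omega
    subst this
    rfl
  · intro l hl
    rw [mem_W] at hl
    obtain ⟨⟨h1, h2⟩, h3⟩ := hl
    obtain ⟨L, M, rfl⟩ := List.append_of_mem ((h2 b).2 (by omega))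
    rw [List.nodup_append, List.nodup_cons] at h1
    obtain ⟨l1, ⟨m0, m1⟩, hd⟩ := h1
    have hL : ∀ y ∈ L, y < b := fun y hy => by
      have := (h2 y).1 (by simp [hy])
      have := hd y hy b (by simp)
      omega
    have hM : ∀ y ∈ M, y < b := fun y hy => by
      have := (h2 y).1 (by simp [hy])
      have : y ≠ b := by rintro rfl; exact m0 hy
      omega
    rw [triple231 L M b hL hM (fun y hy hy' => hd y hy y (by simp [hy']) rfl)] at h3
    obtain ⟨⟨l3, m3⟩, h4⟩ := h3
    obtain ⟨c, c1, c2, l2, m2⟩ := split_interval L M a b hab (fun y => by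
      constructor
      · rintro (h | h)
        · exact ⟨((h2 y).1 (by simp [h])).1, hL y h⟩
        · exact ⟨((h2 y).1 (by simp [h])).1, hM y h⟩
      · intro h
        have := (h2 y).2 (by omega)
        rw [List.mem_append, List.mem_cons] at this
        have : y ≠ b := by omega
        tauto) h4
    refine ⟨⟨c, L, M⟩, ?_, rfl⟩
    simp only [Finset.mem_sigma, Finset.mem_Icc, Finset.mem_product, mem_W]
    exact ⟨⟨c1, c2⟩, ⟨⟨l1, l2⟩, l3⟩, ⟨m1, m2⟩, m3⟩
  · rintro ⟨c, L, M⟩ hq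
    simp only [Finset.mem_sigma, Finset.mem_Icc, Finset.mem_product] at hq
    obtain ⟨⟨hc1, hc2⟩, hL, hM⟩ := hq
    have e := length_of_W hM
    rw [mem_W] at hL hM
    dsimp only
    rw [wt_append_lt x L M b (fun y => by rw [hL.1.2]; omega),
      wt_cons_gt x M b (fun y => by rw [hM.1.2]; omega)]
    have : M = [] ↔ c = b := by rw [← List.length_eq_zero_iff]; omega
    simp only [this]
    ring

lemma rec132 (a b : ℕ) (hab : a ≤ b) : F x p132 a (b + 1) =
    ∑ c ∈ Finset.Icc a b, F x p132 c b * F x p132 a c * (if c = a then 1 else x b) := by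
  simp only [F, Finset.sum_mul_sum]
  simp only [Finset.sum_mul]
  simp only [← Finset.sum_product']
  rw [Finset.sum_sigma']
  symm
  refine Finset.sum_bij (fun q _ => q.2.1 ++ b :: q.2.2) ?_ ?_ ?_ ?_
  · rintro ⟨c, L, M⟩ hq
    simp only [Finset.mem_sigma, Finset.mem_Icc, Finset.mem_product] at hq
    obtain ⟨⟨hc1, hc2⟩, hL, hM⟩ := hq
    rw [mem_W] at hL hM ⊢
    obtain ⟨⟨l1, l2⟩, l3⟩ := hL
    obtain ⟨⟨m1, m2⟩, m3⟩ := hM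
    refine ⟨⟨?_, ?_⟩, (triple132 L M b ?_ ?_ ?_).2 ⟨⟨l3, m3⟩, ?_⟩⟩
    · rw [List.nodup_append, List.nodup_cons]
      refine ⟨l1, ⟨by rw [m2]; omega, m1⟩, ?_⟩
      intro u hu v hv
      rw [l2] at hu
      rw [List.mem_cons, m2] at hv
      omega
    · intro u
      simp only [List.mem_append, List.mem_cons, l2, m2]
      omega
    · intro y; rw [l2]; omega
    · intro y; rw [m2]; omega
    · intro y; rw [l2, m2]; omega
    · intro y hy z hz; rw [l2] at hy; rw [m2] at hz; omega
  · rintro ⟨c, L, M⟩ hq ⟨c', L', M'⟩ hq' he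
    simp only [Finset.mem_sigma, Finset.mem_Icc, Finset.mem_product] at hq hq' he
    obtain ⟨⟨hc1, hc2⟩, hL, hM⟩ := hq
    obtain ⟨⟨hc1', hc2'⟩, hL', hM'⟩ := hq'
    have e1 := length_of_W hL
    have e2 := length_of_W hL'
    rw [mem_W] at hL hM
    have hLL : L = L' ∧ M = M' := by
      have := (List.append_cons_inj_of_notMem (x₁ := L) (x₂ := L') (z₁ := M) (z₂ := M') (a₁ := b) (a₂ := b)
        (by rw [hL.1.2]; omega) (by rw [hM.1.2]; omega)).1 he
      tauto
    obtain ⟨rfl, rfl⟩ := hLL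
    have : c = c' := by omega
    subst this
    rfl
  · intro l hl
    rw [mem_W] at hl
    obtain ⟨⟨h1, h2⟩, h3⟩ := hl
    obtain ⟨L, M, rfl⟩ := List.append_of_mem ((h2 b).2 (by omega))
    rw [List.nodup_append, List.nodup_cons] at h1
    obtain ⟨l1, ⟨m0, m1⟩, hd⟩ := h1
    have hL : ∀ y ∈ L, y < b := fun y hy => by
      have := (h2 y).1 (by simp [hy])
      have := hd y hy b (by simp)
      omega
    have hM : ∀ y ∈ M, y < b := fun y hy => by
      have := (h2 y).1 (by simp [hy])
      have : y ≠ b := by rintro rfl; exact m0 hy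
      omega
    rw [triple132 L M b hL hM (fun y hy hy' => hd y hy y (by simp [hy']) rfl)] at h3
    obtain ⟨⟨l3, m3⟩, h4⟩ := h3
    obtain ⟨c, c1, c2, m2, l2⟩ := split_interval M L a b hab (fun y => by
      constructor
      · rintro (h | h)
        · exact ⟨((h2 y).1 (by simp [h])).1, hM y h⟩
        · exact ⟨((h2 y).1 (by simp [h])).1, hL y h⟩
      · intro h
        have := (h2 y).2 (by omega)
        rw [List.mem_append, List.mem_cons] at this
        have : y ≠ b := by omega
        tauto) (fun y hy z hz => h4 z hz y hy)
    refine ⟨⟨c, L, M⟩, ?_, rfl⟩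
    simp only [Finset.mem_sigma, Finset.mem_Icc, Finset.mem_product, mem_W]
    exact ⟨⟨c1, c2⟩, ⟨⟨l1, l2⟩, l3⟩, ⟨m1, m2⟩, m3⟩
  · rintro ⟨c, L, M⟩ hq
    simp only [Finset.mem_sigma, Finset.mem_Icc, Finset.mem_product] at hq
    obtain ⟨⟨hc1, hc2⟩, hL, hM⟩ := hq
    have e := length_of_W hM
    rw [mem_W] at hL hM
    dsimp only
    rw [wt_append_lt x L M b (fun y => by rw [hL.1.2]; omega),
      wt_cons_gt x M b (fun y => by rw [hM.1.2]; omega)]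
    have : M = [] ↔ c = a := by rw [← List.length_eq_zero_iff]; omega
    simp only [this]
    ring

/-- the common bijection for the two 312 recursions -/
lemma bij312 (a b : ℕ) (hab : a < b) (f g h : List ℕ → R) (k : ℕ → R)
    (H : ∀ S B c, (∀ y ∈ S, y < c) → (∀ y ∈ B, c < y) → f (S ++ B ++ [c]) = g S * h B * k c) :
    ∑ l ∈ W p312 a b, f l = 
    ∑ c ∈ Finset.Ico a b, (∑ l ∈ W p312 a c, g l) * (∑ l ∈ W p312 (c + 1) b, h l) * k c := by
  simp only [Finset.sum_mul_sum]
  simp only [Finset.sum_mul]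
  simp only [← Finset.sum_product']
  rw [Finset.sum_sigma']
  symm
  refine Finset.sum_bij (fun q _ => q.2.1 ++ q.2.2 ++ [q.1]) ?_ ?_ ?_ ?_
  · rintro ⟨c, L, M⟩ hq
    simp only [Finset.mem_sigma, Finset.mem_Ico, Finset.mem_product] at hq
    obtain ⟨⟨hc1, hc2⟩, hL, hM⟩ := hq
    rw [mem_W] at hL hM ⊢
    obtain ⟨⟨l1, l2⟩, l3⟩ := hL
    obtain ⟨⟨m1, m2⟩, m3⟩ := hM
    refine ⟨⟨?_, ?_⟩, (triple312 L M c ?_ ?_ ?_ ?_).2 ⟨l3, m3⟩⟩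
    · rw [List.nodup_append, List.nodup_append]
      refine ⟨⟨l1, m1, ?_⟩, by simp, ?_⟩
      · intro u hu v hv
        rw [l2] at hu
        rw [m2] at hv
        omega
      · intro u hu v hv
        rw [List.mem_append, l2, m2] at hu
        rw [List.mem_singleton] at hv
        change v = c at hv
        omega
    · intro u
      simp only [List.mem_append, List.mem_singleton, l2, m2]
      omega
    · rw [l2]; omega
    · rw [m2]; omega
    · intro y; rw [l2]; omega
    · intro y; rw [m2]; omega
  · rintro ⟨c, L, M⟩ hq ⟨c', L', M'⟩ hq' he
    simp only [Finset.mem_sigma, Finset.mem_Ico, Finset.mem_product] at hq hq' he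
    obtain ⟨⟨hc1, hc2⟩, hL, hM⟩ := hq
    obtain ⟨⟨hc1', hc2'⟩, hL', hM'⟩ := hq'
    have e1 := length_of_W hL
    have e2 := length_of_W hL'
    have he1 := List.append_inj' he rfl
    obtain rfl : c = c' := by simpa using he1.2
    have he2 := List.append_inj he1.1 (e1.trans e2.symm)
    obtain ⟨rfl, rfl⟩ := he2
    rfl
  · intro l hl
    rw [mem_W] at hl
    obtain ⟨⟨h1, h2⟩, h3⟩ := hl
    rcases List.eq_nil_or_concat l with rfl | ⟨l, c, rfl⟩
    · have := (h2 a).2 (by omega)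
      simp at this
    rw [List.concat_eq_append] at h1 h2 h3 ⊢
    have hc := (h2 c).1 (by simp)
    rw [List.nodup_append] at h1
    have hcl : c ∉ l := fun h => h1.2.2 c h c (by simp) rfl
    obtain ⟨L, M, rfl, hL, hM⟩ := exists_split312 l c hcl
      ((List.triplewise_append.1 h3).2.2.2 c (by simp))
    have hcL : c ∉ L := fun h => hcl (by simp [h])
    have hcM : c ∉ M := fun h => hcl (by simp [h])
    rw [triple312 L M c hcL hcM hL hM] at h3
    have h1' := List.nodup_append.1 h1.1
    refine ⟨⟨c, L, M⟩, ?_, rfl⟩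
    simp only [Finset.mem_sigma, Finset.mem_Ico, Finset.mem_product, mem_W]
    simp only [List.mem_append, List.mem_singleton] at h2
    refine ⟨hc, ⟨⟨h1'.1, fun y => ?_⟩, h3.1⟩, ⟨h1'.2.1, fun y => ?_⟩, h3.2⟩
    · constructor
      · intro h
        exact ⟨((h2 y).1 (by tauto)).1, hL y h⟩
      · intro h
        rcases (h2 y).2 (by omega) with (h' | h') | h'
        · exact h'
        · have := hM y h'; omega
        · omega
    · constructor
      · intro h
        exact ⟨hM y h, ((h2 y).1 (by tauto)).2⟩
      · intro h
        rcases (h2 y).2 (by omega) with (h' | h') | h'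
        · have := hL y h'; omega
        · exact h'
        · omega
  · rintro ⟨c, L, M⟩ hq
    simp only [Finset.mem_sigma, Finset.mem_Ico, Finset.mem_product] at hq
    obtain ⟨⟨hc1, hc2⟩, hL, hM⟩ := hq
    rw [mem_W] at hL hM
    rw [H L M c (fun y => by rw [hL.1.2]; omega) (fun y => by rw [hM.1.2]; omega)]

lemma rec312 (a b : ℕ) (hab : a < b) : F x p312 a b =
    ∑ c ∈ Finset.Ico a b, F x p312 a c * FS x p312 (c + 1) b := by
  have := bij312 a b hab (wt x) (wt x) (ws x) (fun _ => 1) (by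
    intro S B c hS hB
    rw [List.append_assoc, append_lt_wt, wt_append_gt x B c hB, mul_one]
    intro y hy z hz
    have := hS y hy
    rcases List.mem_append.1 hz with h | h
    · have := hB z h; omega
    · rw [List.mem_singleton] at h; omega)
  simpa [F, FS] using this

lemma rec312s (a b : ℕ) (hab : a < b) : FS x p312 a b =
    ∑ c ∈ Finset.Ico a b, F x p312 a c * FS x p312 (c + 1) b * x c := by
  exact bij312 a b hab (ws x) (wt x) (ws x) x (by
    intro S B c hS hB
    rw [List.append_assoc, append_lt_ws, ws_append_gt x B c hB, mul_assoc]
    · simp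
    intro y hy z hz
    have := hS y hy
    rcases List.mem_append.1 hz with h | h
    · have := hB z h; omega
    · rw [List.mem_singleton] at h; omega)

lemma rec231' (a b : ℕ) (hab : a ≤ b) : F x p231 a (b + 1) =
    F x p231 a b + x b * ∑ c ∈ Finset.Ico a b, F x p231 a c * F x p231 c b := by
  rw [rec231 x a b hab, ← Finset.Ico_insert_right hab, Finset.sum_insert (by simp), F_self,
    Finset.mul_sum]
  simp only [if_true, mul_one]
  congr 1
  refine Finset.sum_congr rfl fun c hc => ?_
  rw [Finset.mem_Ico] at hc
  rw [if_neg (by omega), mul_comm]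

lemma F132_eq (n : ℕ) : ∀ a b, b = a + n → F x p132 a b = F x p231 a b := by
  induction n using Nat.strong_induction_on with
  | _ n ih =>
    rintro a b rfl
    cases n with
    | zero => simp [F_self]
    | succ n =>
      have e : ∀ u v, u ≤ v → v ≤ u + n → F x p132 u v = F x p231 u v :=
        fun u v h1 h2 => ih (v - u) (by omega) u v (by omega)
      rw [← add_assoc, rec231' x a _ (by omega), rec132 x a _ (by omega)]
      rw [← Finset.Ioc_insert_left (by omega : a ≤ a + n), Finset.sum_insert (by simp), F_self]
      simp only [if_true, mul_one]
      rw [e a _ (by omega) (by omega)]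
      congr 1
      have : ∀ c ∈ Finset.Ioc a (a + n), 
          F x p132 c (a + n) * F x p132 a c * (if c = a then 1 else x (a + n)) = 
          x (a + n) * (F x p231 a c * F x p231 c (a + n)) := by
        intro c hc
        rw [Finset.mem_Ioc] at hc
        rw [if_neg (by omega), e c _ (by omega) (by omega), e a c (by omega) (by omega)]
        ring
      rw [Finset.sum_congr rfl this, ← Finset.mul_sum]
      congr 1
      rcases Nat.eq_zero_or_pos n with rfl | hn
      · simp
      · rw [← Finset.Ioo_insert_right (by omega : a < a + n), Finset.sum_insert (by simp),
          ← Finset.Ioo_insert_left (by omega : a < a + n), Finset.sum_insert (by simp)]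
        simp [F_self]

lemma star (a n : ℕ) : F x p231 a (a + 1 + n) = F x p231 (a + 1) (a + 1 + n) +
    ∑ l ∈ Finset.Ico (a + 1) (a + 1 + n), x l * F x p231 (a + 1) l * F x p231 l (a + 1 + n) := by
  induction n using Nat.strong_induction_on with
  | _ n ih =>
    cases n with
    | zero => 
      have := rec231' x a a le_rfl
      simpa [F_self] using this
    | succ n =>
      set c := a + 1 + n with hc
      have IH : ∀ k, a + 1 ≤ k → k ≤ c → F x p231 a k = F x p231 (a + 1) k +
          ∑ l ∈ Finset.Ico (a + 1) k, x l * F x p231 (a + 1) l * F x p231 l k := by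
        intro k h1 h2
        have := ih (k - (a + 1)) (by omega)
        rwa [show a + 1 + (k - (a + 1)) = k by omega] at this
      have hcc : F x p231 c (c + 1) = 1 := by
        have := rec231' x c c le_rfl
        simpa [F_self] using this
      rw [← add_assoc, ← hc, Finset.sum_Ico_succ_top (by omega), hcc]
      have e1 : ∑ l ∈ Finset.Ico (a + 1) c, x l * F x p231 (a + 1) l * F x p231 l (c + 1) =
          ∑ l ∈ Finset.Ico (a + 1) c, x l * F x p231 (a + 1) l * F x p231 l c + 
          x c * ∑ k ∈ Finset.Ico (a + 1) c, ∑ l ∈ Finset.Ico (a + 1) (k + 1), 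
            x l * F x p231 (a + 1) l * F x p231 l k * F x p231 k c := by
        have e0 : ∀ l ∈ Finset.Ico (a + 1) c,
            x l * F x p231 (a + 1) l * F x p231 l (c + 1) =
            x l * F x p231 (a + 1) l * F x p231 l c + x c * ∑ k ∈ Finset.Ico l c,
            x l * F x p231 (a + 1) l * F x p231 l k * F x p231 k c := by
          intro l hl
          rw [Finset.mem_Ico] at hl
          rw [rec231' x l c (by omega), mul_add, mul_left_comm, Finset.mul_sum]
          congr 2
          refine Finset.sum_congr rfl fun k _ => ?_
          ring
        rw [Finset.sum_congr rfl e0, Finset.sum_add_distrib, ← Finset.mul_sum]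
        congr 2
        refine Finset.sum_comm' fun l k => ?_
        simp only [Finset.mem_Ico]
        omega
      rw [rec231' x a c (by omega), rec231' x (a + 1) c (by omega), e1, IH c (by omega) le_rfl,
        Finset.sum_eq_sum_Ico_succ_bot (by omega : a < c), F_self]
      have e2 : ∑ k ∈ Finset.Ico (a + 1) c, ∑ l ∈ Finset.Ico (a + 1) (k + 1), 
            x l * F x p231 (a + 1) l * F x p231 l k * F x p231 k c = 
          ∑ k ∈ Finset.Ico (a + 1) c, F x p231 a k * F x p231 k c 
          - ∑ k ∈ Finset.Ico (a + 1) c, F x p231 (a + 1) k * F x p231 k c 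
          + ∑ k ∈ Finset.Ico (a + 1) c, x k * F x p231 (a + 1) k * F x p231 k c := by
        rw [← Finset.sum_sub_distrib, ← Finset.sum_add_distrib]
        refine Finset.sum_congr rfl fun k hk => ?_
        rw [Finset.mem_Ico] at hk
        rw [← Finset.sum_mul, Finset.sum_Ico_succ_top (by omega), F_self, 
          IH k (by omega) (by omega)]
        ring
      rw [e2, IH c (by omega) le_rfl]
      ring

lemma F312_eq (n : ℕ) : ∀ a, F x p312 a (a + n) = F x p231 a (a + n) ∧
    (0 < n → FS x p312 (a + 1) (a + 1 + n) = x (a + n) * F x p231 a (a + n)) := by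
  induction n using Nat.strong_induction_on with
  | _ n ih =>
    intro a
    have e : ∀ u v, u ≤ v → v < u + n → F x p312 u v = F x p231 u v := fun u v h1 h2 => by
      have := (ih (v - u) (by omega) u).1
      rwa [show u + (v - u) = v by omega] at this
    have es : ∀ u v, u < v → v < u + n → FS x p312 (u + 1) (v + 1) = x v * F x p231 u v :=
      fun u v h1 h2 => by
      have := (ih (v - u) (by omega) u).2 (by omega)
      rwa [show u + (v - u) = v by omega, show u + 1 + (v - u) = v + 1 by omega] at this
    cases n with
    | zero => simp [F_self]
    | succ n =>
      refine ⟨?_, fun _ => ?_⟩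
      · rw [← add_assoc, rec312 x a _ (by omega), rec231' x a _ (by omega),
          Finset.sum_Ico_succ_top (by omega), FS_self, e a _ (by omega) (by omega), mul_one, 
          add_comm, Finset.mul_sum]
        congr 1
        refine Finset.sum_congr rfl fun c hc => ?_
        rw [Finset.mem_Ico] at hc
        rw [e a c (by omega) (by omega), es c _ (by omega) (by omega)]
        ring
      · have h1 : a + (n + 1) = a + 1 + n := by omega
        have h2 : a + 1 + (n + 1) = a + 1 + n + 1 := by omega
        rw [h1, h2, rec312s x _ _ (by omega), Finset.sum_Ico_succ_top (by omega), FS_self, 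
          star x a n, e _ _ (by omega) (by omega), mul_add, Finset.mul_sum, add_comm]
        congr 1
        · ring
        refine Finset.sum_congr rfl fun c hc => ?_
        rw [Finset.mem_Ico] at hc
        rw [e _ c (by omega) (by omega), es c _ (by omega) (by omega)]
        ring

end weights

lemma wt_eq_prod {R : Type*} [CommRing R] (x : ℕ → R) (l : List ℕ) :
    wt x l = ∏ i ∈ Finset.range (l.length - 1),
      (if l.getD (i + 1) 0 < l.getD i 0 then x (l.getD i 0) else 1) := by
  induction l with
  | nil => simp [wt]
  | cons a l ih =>
    cases l with
    | nil => simp [wt]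
    | cons b l =>
      simp only [List.length_cons, Nat.add_sub_cancel] at ih ⊢
      rw [Finset.prod_range_succ', wt, ih, mul_comm]
      simp

/-- One-line notation as a list. -/
def toL {n : ℕ} (σ : Equiv.Perm (Fin n)) : List ℕ := List.ofFn fun i => (σ i : ℕ) + 1

lemma toL_getD {n : ℕ} (σ : Equiv.Perm (Fin n)) (i : ℕ) (h : i < n) :
    (toL σ).getD i 0 = entry σ (i + 1) := by
  simp [toL, entry, h]

lemma entry_injOn {n : ℕ} (σ : Equiv.Perm (Fin n)) :
    Set.InjOn (entry σ) (Des σ : Set ℕ) := by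
  intro i hi j hj h
  simp only [Des, Finset.coe_filter, Finset.mem_Icc, Set.mem_ofPred_eq] at hi hj
  have h1 : i - 1 < n := by omega
  have h2 : j - 1 < n := by omega
  simp only [entry, h1, h2, dif_pos] at h
  have h3 : σ ⟨i - 1, h1⟩ = σ ⟨j - 1, h2⟩ := by
    apply Fin.ext; omega
  have := congrArg Fin.val (σ.injective h3)
  simp only at this
  omega

lemma wt_toL {R : Type*} [CommRing R] (x : ℕ → R) {n : ℕ} (σ : Equiv.Perm (Fin n)) :
    wt x (toL σ) = ∏ t ∈ Destop σ, x t := by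
  rw [wt_eq_prod, Destop, Finset.prod_image (entry_injOn σ), Des, Finset.prod_filter]
  have hl : (toL σ).length = n := by simp [toL]
  rw [hl]
  refine Finset.prod_bij (fun i _ => i + 1) ?_ ?_ ?_ ?_
  · intro i hi
    simp only [Finset.mem_range, Finset.mem_Icc] at hi ⊢
    omega
  · intro i _ j _ h
    omega
  · intro j hj
    simp only [Finset.mem_Icc] at hj
    exact ⟨j - 1, by simp only [Finset.mem_range]; omega, by omega⟩
  · intro i hi
    simp only [Finset.mem_range] at hi
    rw [toL_getD σ i (by omega), toL_getD σ (i + 1) (by omega)]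

lemma toL_triple (p : ℕ → ℕ → ℕ → Prop) {n : ℕ} (σ : Equiv.Perm (Fin n)) :
    (toL σ).Triplewise p ↔ ∀ i j k : Fin n, i < j → j < k →
      p (σ i + 1) (σ j + 1) (σ k + 1) := by
  rw [List.triplewise_iff_getElem]
  constructor
  · intro h i j k hij hjk
    have := h i j k hij hjk (by simp [toL])
    simpa [toL] using this
  · intro h i j k hij hjk hk
    have hk' : k < n := by simpa [toL] using hk
    have := h ⟨i, by omega⟩ ⟨j, by omega⟩ ⟨k, hk'⟩ hij hjk
    simpa [toL] using this

lemma contains_iff {n : ℕ} (π : Fin 3 → Fin 3) (σ : Equiv.Perm (Fin n)) :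
    Contains π σ ↔ ∃ i j k : Fin n, i < j ∧ j < k ∧
      ∀ u v : Fin 3, π u < π v ↔ σ (![i, j, k] u) < σ (![i, j, k] v) := by
  constructor
  · rintro ⟨f, hf, h⟩
    refine ⟨f 0, f 1, f 2, hf (by decide), hf (by decide), ?_⟩
    have : ![f 0, f 1, f 2] = f := by
      ext i; fin_cases i <;> rfl
    rw [this]
    exact h
  · rintro ⟨i, j, k, hij, hjk, h⟩
    refine ⟨![i, j, k], ?_, h⟩
    have hik := hij.trans hjk
    intro u v huv
    fin_cases u <;> fin_cases v <;> simp_all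

lemma avoids231 {n : ℕ} (σ : Equiv.Perm (Fin n)) :
    AvoidsPat (![1, 2, 0] : Fin 3 → Fin 3) σ ↔ (toL σ).Triplewise p231 := by
  rw [AvoidsPat, contains_iff, toL_triple]
  simp only [not_exists, not_and]
  refine forall_congr' fun i => forall_congr' fun j => forall_congr' fun k =>
    forall_congr' fun hij => forall_congr' fun hjk => ?_
  rw [← not_iff_not]
  simp only [Fin.forall_fin_succ, Fin.lt_def, p231]
  simp
  omega

lemma avoids132 {n : ℕ} (σ : Equiv.Perm (Fin n)) :
    AvoidsPat (![0, 2, 1] : Fin 3 → Fin 3) σ ↔ (toL σ).Triplewise p132 := by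
  rw [AvoidsPat, contains_iff, toL_triple]
  simp only [not_exists, not_and]
  refine forall_congr' fun i => forall_congr' fun j => forall_congr' fun k =>
    forall_congr' fun hij => forall_congr' fun hjk => ?_
  rw [← not_iff_not]
  simp only [Fin.forall_fin_succ, Fin.lt_def, p132]
  simp
  omega

lemma avoids312 {n : ℕ} (σ : Equiv.Perm (Fin n)) :
    AvoidsPat (![2, 0, 1] : Fin 3 → Fin 3) σ ↔ (toL σ).Triplewise p312 := by
  rw [AvoidsPat, contains_iff, toL_triple]
  simp only [not_exists, not_and]
  refine forall_congr' fun i => forall_congr' fun j => forall_congr' fun k =>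
    forall_congr' fun hij => forall_congr' fun hjk => ?_
  rw [← not_iff_not]
  simp only [Fin.forall_fin_succ, Fin.lt_def, p312]
  simp
  omega

lemma sum_perm {R : Type*} [CommRing R] (x : ℕ → R) (p : ℕ → ℕ → ℕ → Prop) (n : ℕ) :
    ∑ σ ∈ (Finset.univ : Finset (Equiv.Perm (Fin n))).filter (fun σ => (toL σ).Triplewise p),
      ∏ t ∈ Destop σ, x t = F x p 1 (1 + n) := by
  unfold F
  refine Finset.sum_bij (fun σ _ => toL σ) ?_ ?_ ?_ ?_
  · intro σ hσ
    rw [mem_W]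
    refine ⟨⟨?_, fun y => ?_⟩, (Finset.mem_filter.1 hσ).2⟩
    · rw [toL, List.nodup_ofFn]
      intro i j h
      apply σ.injective
      apply Fin.ext
      simpa using h
    · simp only [toL, List.mem_ofFn]
      constructor
      · rintro ⟨i, rfl⟩
        have := (σ i).2
        omega
      · intro h
        refine ⟨σ.symm ⟨y - 1, by omega⟩, ?_⟩
        simp
        omega
  · intro σ _ τ _ h
    have := List.ofFn_injective h
    ext i
    have := congrFun this i
    omega
  · intro l hl
    have hlen := length_of_W hl
    obtain ⟨⟨h1, h2⟩, h3⟩ := mem_W.1 hl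
    have hn : l.length = n := by omega
    subst hn
    have hm : ∀ i : Fin l.length, 1 ≤ l[i] ∧ l[i] < 1 + l.length := fun i =>
      (h2 _).1 (List.getElem_mem _)
    let f : Fin l.length → Fin l.length := fun i => ⟨l[i] - 1, by have := hm i; omega⟩
    have hf : Function.Injective f := by
      intro i j h
      have h' : l[i] - 1 = l[j] - 1 := congrArg Fin.val h
      have := hm i
      have := hm j
      have h'' : l[i.1] = l[j.1] := by
        have : l[i] = l[j] := by omega
        exact this
      exact Fin.ext ((h1.getElem_inj_iff).1 h'')
    let σ : Equiv.Perm (Fin l.length) := Equiv.ofBijective f (Finite.injective_iff_bijective.1 hf)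
    have hσ : toL σ = l := by
      refine List.ext_getElem (by simp [toL]) fun i h h' => ?_
      have := hm ⟨i, h'⟩
      simp only [toL, List.getElem_ofFn]
      change l[i] - 1 + 1 = l[i]
      have : 1 ≤ l[i] := this.1
      omega
    exact ⟨σ, Finset.mem_filter.2 ⟨Finset.mem_univ _, by rw [hσ]; exact h3⟩, hσ⟩
  · intro σ _
    rw [wt_toL]

lemma coeff_prod (D T : Finset ℕ) :
    MvPolynomial.coeff (∑ t ∈ T, Finsupp.single t 1) (∏ t ∈ D, (MvPolynomial.X t : MvPolynomial ℕ ℤ))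
      = if D = T then 1 else 0 := by
  have h1 : (∏ t ∈ D, (MvPolynomial.X t : MvPolynomial ℕ ℤ)) =
      MvPolynomial.monomial (∑ t ∈ D, Finsupp.single t 1) 1 := by
    rw [MvPolynomial.monomial_sum_one]
    rfl
  have h2 : ∀ (S : Finset ℕ) (u : ℕ), (∑ t ∈ S, Finsupp.single t 1 : ℕ →₀ ℕ) u = if u ∈ S then 1 else 0 := by
    intro S u
    simp [Finsupp.finsetSum_apply, Finsupp.single_apply]
  rw [h1, MvPolynomial.coeff_monomial]
  congr 1
  apply propext
  constructor
  · intro h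
    ext u
    have := DFunLike.congr_fun h u
    rw [h2, h2] at this
    by_cases hu : u ∈ D <;> by_cases hv : u ∈ T <;> simp_all
  · rintro rfl; rfl

lemma card_eq (p : ℕ → ℕ → ℕ → Prop) (n : ℕ) (T : Finset ℕ) (Q : Equiv.Perm (Fin n) → Prop)
    (hQ : ∀ σ, Q σ ↔ (toL σ).Triplewise p) :
    (((Finset.univ : Finset (Equiv.Perm (Fin n))).filter
      (fun σ => Q σ ∧ Destop σ = T)).card : ℤ) =
    MvPolynomial.coeff (∑ t ∈ T, Finsupp.single t 1)
      (F (fun t => (MvPolynomial.X t : MvPolynomial ℕ ℤ)) p 1 (1 + n)) := by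
  rw [← sum_perm, MvPolynomial.coeff_sum]
  simp only [coeff_prod, hQ]
  rw [← Finset.filter_filter, Finset.card_filter]
  push_cast
  rfl

end DW

/-- The patterns 132, 231, 312 are Destop-Wilf equivalent. -/
theorem destop_wilf_132_231_312 (n : ℕ) (T : Finset ℕ) (hT : T ⊆ Finset.Icc 1 n) :
    ((Finset.univ : Finset (Equiv.Perm (Fin n))).filter
        (fun σ => AvoidsPat (![0, 2, 1] : Fin 3 → Fin 3) σ ∧ Destop σ = T)).card =
      ((Finset.univ : Finset (Equiv.Perm (Fin n))).filter
        (fun σ => AvoidsPat (![1, 2, 0] : Fin 3 → Fin 3) σ ∧ Destop σ = T)).card ∧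
    ((Finset.univ : Finset (Equiv.Perm (Fin n))).filter
        (fun σ => AvoidsPat (![1, 2, 0] : Fin 3 → Fin 3) σ ∧ Destop σ = T)).card =
      ((Finset.univ : Finset (Equiv.Perm (Fin n))).filter
        (fun σ => AvoidsPat (![2, 0, 1] : Fin 3 → Fin 3) σ ∧ Destop σ = T)).card := by
  constructor
  · zify
    rw [DW.card_eq DW.p132 n T _ DW.avoids132, DW.card_eq DW.p231 n T _ DW.avoids231,
      DW.F132_eq _ n 1 (1 + n) rfl]
  · zify
    rw [DW.card_eq DW.p231 n T _ DW.avoids231, DW.card_eq DW.p312 n T _ DW.avoids312,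
      (DW.F312_eq _ n 1).1]
end

section
/- Let (T, B) be a descent matching of size k, and let n be an integer with n ≥ max(T) if k > 0, or n ≥ 0 arbitrary if k = 0. Then there exists a unique permutation σ ∈ Av_n(312) such that Destop(σ) = T and Desbot(σ) = B. -/
open scoped Classical

/-- number of bottoms `≤ x` minus number of tops `≤ x`. -/
noncomputable def hgt (T B : Finset ℕ) (x : ℕ) : ℤ :=
  ((B.filter (fun b => b ≤ x)).card : ℤ) - ((T.filter (fun t => t ≤ x)).card : ℤ)

/-- number of bottoms `< a` minus number of tops `≤ a`. -/
noncomputable def kht (T B : Finset ℕ) (a : ℕ) : ℤ :=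
  ((B.filter (fun b => b < a)).card : ℤ) - ((T.filter (fun t => t ≤ a)).card : ℤ)

/-- the inversion relation: `c` comes before `a` although `a < c`. -/
def InvR (T B : Finset ℕ) (a c : ℕ) : Prop :=
  a < c ∧ ∀ x, a ≤ x → x < c → kht T B a < hgt T B x

/-- the order of values in the word. -/
def Bef (T B : Finset ℕ) (a c : ℕ) : Prop :=
  (a < c ∧ ¬ InvR T B a c) ∨ InvR T B c a

lemma card_le_split (B : Finset ℕ) (x : ℕ) :
    (B.filter (fun b => b ≤ x)).card = (B.filter (fun b => b < x)).card + if x ∈ B then 1 else 0 := by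
  have : B.filter (fun b => b ≤ x) = B.filter (fun b => b < x) ∪ B.filter (fun b => b = x) := by
    ext b; simp only [Finset.mem_filter, Finset.mem_union]; have := @Nat.le_iff_lt_or_eq b x; tauto
  rw [this, Finset.card_union_of_disjoint]
  · congr 1
    rw [Finset.filter_eq']
    split_ifs <;> simp
  · rw [Finset.disjoint_left]
    intro b; simp only [Finset.mem_filter]; intro h1 h2; omega

lemma hgt_eq_kht (T B : Finset ℕ) (x : ℕ) :
    hgt T B x = kht T B x + if x ∈ B then 1 else 0 := by
  unfold hgt kht; rw [card_le_split B x]; push_cast; ring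

lemma kht_succ (T B : Finset ℕ) (x : ℕ) :
    kht T B (x + 1) = hgt T B x - if x + 1 ∈ T then 1 else 0 := by
  unfold hgt kht; rw [card_le_split T (x + 1)]
  simp only [Nat.lt_succ_iff]
  push_cast; ring

lemma kht_le_hgt (T B : Finset ℕ) (x : ℕ) : kht T B x ≤ hgt T B x := by
  rw [hgt_eq_kht]; split_ifs <;> omega

lemma InvR.trans {T B : Finset ℕ} {a c d : ℕ} (h1 : InvR T B a c) (h2 : InvR T B c d) :
    InvR T B a d := by
  refine ⟨h1.1.trans h2.1, fun x hx hxd => ?_⟩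
  rcases lt_or_ge x c with h | h
  · exact h1.2 x hx h
  · have := h2.2 x h hxd
    have h3 := h1.1
    obtain ⟨y, rfl⟩ : ∃ y, c = y + 1 := ⟨c - 1, by omega⟩
    have h4 := h1.2 y (by omega) (by omega)
    rw [kht_succ] at this
    split_ifs at this <;> omega

lemma InvR.cotrans {T B : Finset ℕ} {a c d : ℕ} (h1 : InvR T B a d) (h2 : a < c) (h3 : c < d) :
    InvR T B a c := ⟨h2, fun x hx hxc => h1.2 x hx (by omega)⟩

lemma Bef.irrefl {T B : Finset ℕ} {a : ℕ} (h : Bef T B a a) : False := by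
  rcases h with h | h
  · exact absurd h.1 (lt_irrefl _)
  · exact absurd h.1 (lt_irrefl _)

lemma Bef.total {T B : Finset ℕ} {a c : ℕ} (h : a ≠ c) : Bef T B a c ∨ Bef T B c a := by
  unfold Bef
  rcases lt_or_gt_of_ne h with h | h
  · by_cases h' : InvR T B a c <;> tauto
  · by_cases h' : InvR T B c a <;> tauto

lemma Bef.trans {T B : Finset ℕ} {x y z : ℕ} (h1 : Bef T B x y) (h2 : Bef T B y z) :
    Bef T B x z := by
  rcases h1 with ⟨h1, h1'⟩ | h1 <;> rcases h2 with ⟨h2, h2'⟩ | h2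
  · exact Or.inl ⟨h1.trans h2, fun h => h1' (h.cotrans h1 h2)⟩
  · rcases lt_trichotomy x z with h | h | h
    · exact Or.inl ⟨h, fun h' => h1' (h'.trans h2)⟩
    · subst h; exact absurd h2 h1'
    · exact Or.inr (h2.cotrans h h1)
  · rcases lt_trichotomy x z with h | h | h
    · exact Or.inl ⟨h, fun h' => h2' (h1.trans h')⟩
    · subst h; exact absurd h1 h2'
    · exact absurd (h1.cotrans h2 h) h2'
  · exact Or.inr (h2.trans h1)

lemma Bef.asymm {T B : Finset ℕ} {a c : ℕ} (h : Bef T B a c) (h' : Bef T B c a) : False :=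
  (h.trans h').irrefl

/-- ballot property -/
lemma ballot {T B : Finset ℕ} (h : DescentMatching T B) (v : ℕ) : 0 ≤ kht T B v := by
  obtain ⟨hc, -, -, hlt⟩ := h
  unfold kht
  rw [sub_nonneg, Nat.cast_le]
  have hlT : (T.sort (· ≤ ·)).length = T.card := Finset.length_sort _
  have hlB : (B.sort (· ≤ ·)).length = B.card := Finset.length_sort _
  have key : ∀ t ∈ T, ∃ i, ∃ hi : i < (T.sort (· ≤ ·)).length, (T.sort (· ≤ ·))[i] = t := by
    intro t ht
    exact List.mem_iff_getElem.1 ((Finset.mem_sort (· ≤ ·)).2 ht)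
  choose! f hf hft using key
  apply Finset.card_le_card_of_injOn (fun t => (B.sort (· ≤ ·)).getD (f t) 0)
  · intro t ht
    simp only [Finset.coe_filter, Set.mem_ofPred_eq] at ht ⊢
    have h1 := hf t ht.1
    have h2 := hlt (f t) (by omega)
    rw [List.getD_eq_getElem _ _ h1, hft t ht.1] at h2
    refine ⟨?_, by omega⟩
    rw [List.getD_eq_getElem _ _ (by omega)]
    exact (Finset.mem_sort (· ≤ ·)).1 (List.getElem_mem _)
  · intro s hs t ht hst
    simp only [Finset.coe_filter, Set.mem_ofPred_eq] at hs ht hst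
    have h1 := hf t ht.1
    have h2 := hf s hs.1
    rw [List.getD_eq_getElem _ _ (by omega), List.getD_eq_getElem _ _ (by omega)] at hst
    have h3 := (List.Nodup.getElem_inj_iff (Finset.sort_nodup B (· ≤ ·))).1 hst
    rw [← hft t ht.1, ← hft s hs.1]
    simp only [h3]

lemma bot_lt {T B : Finset ℕ} (h : DescentMatching T B) {n : ℕ} (hn : ∀ t ∈ T, t ≤ n) :
    ∀ b ∈ B, b < n := by
  intro b hb
  have h1 := ballot h n
  unfold kht at h1
  rw [sub_nonneg, Nat.cast_le, Finset.filter_true_of_mem hn, h.1] at h1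
  have h2 : B.filter (fun b => b < n) = B :=
    Finset.eq_of_subset_of_card_le (Finset.filter_subset _ _) h1
  rw [← h2] at hb
  exact (Finset.mem_filter.1 hb).2

lemma inv_of_bot {T B : Finset ℕ} {v : ℕ} (hv : v ∈ B) : InvR T B v (v + 1) := by
  refine ⟨by omega, fun x h1 h2 => ?_⟩
  obtain rfl : x = v := by omega
  rw [hgt_eq_kht, if_pos hv]; omega

lemma bot_of_inv {T B : Finset ℕ} {v w : ℕ} (h : InvR T B v w) : v ∈ B := by
  have := h.2 v le_rfl h.1
  rw [hgt_eq_kht] at this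
  by_contra hv
  rw [if_neg hv] at this; omega

lemma top_partner {T B : Finset ℕ} (h : DescentMatching T B) {v : ℕ} (hv : v ∈ T) :
    ∃ a, a ∈ B ∧ InvR T B a v ∧ kht T B a = kht T B v := by
  have hv0 := h.2.1 v hv
  have h0 : kht T B 0 ≤ kht T B v := by
    refine le_trans ?_ (ballot h v)
    unfold kht; simp
  have hex : ∃ d, d < v ∧ kht T B (v - 1 - d) ≤ kht T B v :=
    ⟨v - 1, by omega, by simpa using h0⟩
  have hs := Nat.find_spec hex
  have hm := fun m hm => Nat.find_min hex (m := m) hm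
  set d := Nat.find hex
  have hkv : hgt T B (v - 1) = kht T B v + 1 := by
    obtain ⟨y, rfl⟩ : ∃ y, v = y + 1 := ⟨v - 1, by omega⟩
    rw [kht_succ, if_pos hv]; simp
  have hgt' : ∀ c, v - 1 - d < c → c < v → kht T B v < kht T B c := by
    intro c h1 h2
    have := hm (v - 1 - c) (by omega)
    rw [show v - 1 - (v - 1 - c) = c by omega] at this
    push Not at this
    exact this (by omega)
  have hall : ∀ x, v - 1 - d ≤ x → x < v → kht T B v < hgt T B x := by
    intro x h1 h2
    rcases Nat.lt_or_ge (x + 1) v with h3 | h3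
    · have h4 := hgt' (x + 1) (by omega) h3
      rw [kht_succ] at h4
      split_ifs at h4 <;> omega
    · obtain rfl : x = v - 1 := by omega
      omega
  have h5 := hall (v - 1 - d) le_rfl (by omega)
  have hB : v - 1 - d ∈ B := by
    by_contra hB
    rw [hgt_eq_kht, if_neg hB] at h5; omega
  rw [hgt_eq_kht, if_pos hB] at h5
  have h6 : kht T B (v - 1 - d) = kht T B v := by omega
  exact ⟨_, hB, ⟨by omega, fun x h1 h2 => by rw [h6]; exact hall x h1 h2⟩, h6⟩

/-! entries -/
lemma entry_eq {n : ℕ} (σ : Equiv.Perm (Fin n)) (i : Fin n) :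
    entry σ (i + 1) = (σ i : ℕ) + 1 := by
  unfold entry; simp

lemma entry_eq' {n : ℕ} (σ : Equiv.Perm (Fin n)) {i : ℕ} (h1 : 1 ≤ i) (h2 : i ≤ n) :
    entry σ i = (σ ⟨i - 1, by omega⟩ : ℕ) + 1 := by
  unfold entry; rw [dif_pos]

lemma entry_inj {n : ℕ} (σ : Equiv.Perm (Fin n)) {i j : ℕ} (h1 : 1 ≤ i) (h2 : i ≤ n)
    (h3 : 1 ≤ j) (h4 : j ≤ n) (h : entry σ i = entry σ j) : i = j := by
  rw [entry_eq' σ h1 h2, entry_eq' σ h3 h4] at h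
  have := σ.injective (Fin.ext (Nat.succ_injective h))
  simp only [Fin.mk.injEq] at this
  omega

lemma entry_bd {n : ℕ} (σ : Equiv.Perm (Fin n)) {i : ℕ} (h1 : 1 ≤ i) (h2 : i ≤ n) :
    1 ≤ entry σ i ∧ entry σ i ≤ n := by
  rw [entry_eq' σ h1 h2]
  have := (σ ⟨i - 1, by omega⟩).2
  omega

lemma entry_surj {n : ℕ} (σ : Equiv.Perm (Fin n)) {v : ℕ} (h1 : 1 ≤ v) (h2 : v ≤ n) :
    ∃ i, 1 ≤ i ∧ i ≤ n ∧ entry σ i = v := by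
  refine ⟨(σ.symm ⟨v - 1, by omega⟩ : ℕ) + 1, by omega, (σ.symm ⟨v - 1, by omega⟩).2, ?_⟩
  rw [entry_eq]; simp; omega

lemma avoids_iff {n : ℕ} (σ : Equiv.Perm (Fin n)) :
    AvoidsPat (![2, 0, 1] : Fin 3 → Fin 3) σ ↔
      ∀ i j k, 1 ≤ i → i < j → j < k → k ≤ n →
        ¬ (entry σ j < entry σ k ∧ entry σ k < entry σ i) := by
  constructor
  · rintro h i j k hi hij hjk hk ⟨h1, h2⟩
    apply h
    rw [entry_eq' σ (by omega) (by omega), entry_eq' σ (i := k) (by omega) (by omega)] at h1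
    rw [entry_eq' σ (by omega) (by omega), entry_eq' σ (i := i) (by omega) (by omega)] at h2
    refine ⟨![⟨i - 1, by omega⟩, ⟨j - 1, by omega⟩, ⟨k - 1, by omega⟩], ?_, ?_⟩
    · intro a b hab
      fin_cases a <;> fin_cases b <;> simp at hab ⊢ <;> omega
    · intro a b
      fin_cases a <;> fin_cases b <;> simp <;> omega
  · rintro h ⟨f, hf, hf'⟩
    have h01 : f 0 < f 1 := hf (by decide)
    have h12 : f 1 < f 2 := hf (by decide)
    have h3 : σ (f 1) < σ (f 2) := (hf' 1 2).1 (by decide)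
    have h4 : σ (f 2) < σ (f 0) := (hf' 2 0).1 (by decide)
    apply h (f 0 + 1) (f 1 + 1) (f 2 + 1) (by omega) (by omega) (by omega) (f 2).2
    rw [entry_eq, entry_eq, entry_eq]
    omega

lemma mem_Des {n : ℕ} (σ : Equiv.Perm (Fin n)) (i : ℕ) :
    i ∈ Des σ ↔ 1 ≤ i ∧ i + 1 ≤ n ∧ entry σ (i + 1) < entry σ i := by
  unfold Des; simp only [Finset.mem_filter, Finset.mem_Icc]; constructor
  · rintro ⟨⟨a, b⟩, c⟩; exact ⟨a, by omega, c⟩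
  · rintro ⟨a, b, c⟩; exact ⟨⟨a, by omega⟩, c⟩

lemma card_filter_top {n : ℕ} (σ : Equiv.Perm (Fin n)) (P : ℕ → Prop) [DecidablePred P] :
    ((Destop σ).filter P).card = ((Des σ).filter (fun i => P (entry σ i))).card := by
  unfold Destop
  rw [Finset.filter_image, Finset.card_image_of_injOn]
  intro i hi j hj hij
  simp only [Finset.coe_filter, Set.mem_ofPred_eq, mem_Des] at hi hj
  exact entry_inj σ (by omega) (by omega) (by omega) (by omega) hij

lemma card_filter_bot {n : ℕ} (σ : Equiv.Perm (Fin n)) (P : ℕ → Prop) [DecidablePred P] :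
    ((Desbot σ).filter P).card = ((Des σ).filter (fun i => P (entry σ (i + 1)))).card := by
  unfold Desbot
  rw [Finset.filter_image, Finset.card_image_of_injOn]
  intro i hi j hj hij
  simp only [Finset.coe_filter, Set.mem_ofPred_eq, mem_Des] at hi hj
  have := entry_inj σ (by omega) (by omega) (by omega) (by omega) hij
  omega

lemma hgt_perm {n : ℕ} (σ : Equiv.Perm (Fin n)) (x : ℕ) : hgt (Destop σ) (Desbot σ) x =
    ((Des σ).filter (fun i => entry σ (i + 1) ≤ x ∧ x < entry σ i)).card := by
  unfold hgt
  rw [card_filter_top, card_filter_bot, sub_eq_iff_eq_add, ← Nat.cast_add, Nat.cast_inj,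
    ← Finset.card_union_of_disjoint]
  · congr 1
    ext i
    simp only [Finset.mem_filter, Finset.mem_union, mem_Des]
    constructor
    · rintro ⟨a, b⟩
      by_cases hx : x < entry σ i
      · exact Or.inl ⟨a, b, hx⟩
      · exact Or.inr ⟨a, by omega⟩
    · rintro (⟨a, b⟩ | ⟨a, b⟩)
      · exact ⟨a, b.1⟩
      · exact ⟨a, by omega⟩
  · rw [Finset.disjoint_left]
    intro i; simp only [Finset.mem_filter]; intro h1 h2; omega

lemma kht_perm {n : ℕ} (σ : Equiv.Perm (Fin n)) (x : ℕ) : kht (Destop σ) (Desbot σ) x =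
    ((Des σ).filter (fun i => entry σ (i + 1) < x ∧ x < entry σ i)).card := by
  unfold kht
  rw [card_filter_top, card_filter_bot, sub_eq_iff_eq_add, ← Nat.cast_add, Nat.cast_inj,
    ← Finset.card_union_of_disjoint]
  · congr 1
    ext i
    simp only [Finset.mem_filter, Finset.mem_union, mem_Des]
    constructor
    · rintro ⟨a, b⟩
      by_cases hx : x < entry σ i
      · exact Or.inl ⟨a, b, hx⟩
      · exact Or.inr ⟨a, by omega⟩
    · rintro (⟨a, b⟩ | ⟨a, b⟩)
      · exact ⟨a, b.1⟩
      · exact ⟨a, by omega⟩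
  · rw [Finset.disjoint_left]
    intro i; simp only [Finset.mem_filter]; intro h1 h2; omega

/-- a walk going from above `x` to at most `x` has a descent crossing `x`. -/
lemma exists_cross (e : ℕ → ℕ) (x q p : ℕ) (hqp : q ≤ p) (hq : x < e q) (hp : e p ≤ x) :
    ∃ i, q ≤ i ∧ i + 1 ≤ p ∧ x < e i ∧ e (i + 1) ≤ x := by
  induction p, hqp using Nat.le_induction with
  | base => omega
  | succ p h ih =>
    by_cases hh : e p ≤ x
    · obtain ⟨i, a, b, c, d⟩ := ih hh
      exact ⟨i, a, by omega, c, d⟩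
    · exact ⟨p, h, le_rfl, by omega, hp⟩

lemma inv_iff {n : ℕ} (σ : Equiv.Perm (Fin n))
    (hav : AvoidsPat (![2, 0, 1] : Fin 3 → Fin 3) σ) {p q : ℕ} (hp1 : 1 ≤ p) (hpn : p ≤ n)
    (hq1 : 1 ≤ q) (hqn : q ≤ n) (hpq : entry σ p < entry σ q) :
    q < p ↔ InvR (Destop σ) (Desbot σ) (entry σ p) (entry σ q) := by
  rw [avoids_iff] at hav
  constructor
  · intro hlt
    refine ⟨hpq, fun x hx1 hx2 => ?_⟩
    rw [hgt_perm, kht_perm, Nat.cast_lt]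
    obtain ⟨i, hi1, hi2, hi3, hi4⟩ := exists_cross (entry σ) x q p hlt.le hx2 hx1
    have haft : ∀ j ∈ Des σ, entry σ (j + 1) < entry σ p → entry σ p < entry σ j → p < j := by
      intro j hj h1 h2
      rw [mem_Des] at hj
      by_contra hcon
      rcases Nat.lt_trichotomy (j + 1) p with h | h | h
      · exact hav j (j + 1) p (by omega) (by omega) h hpn ⟨h1, h2⟩
      · rw [h] at h1; omega
      · have : j = p := by omega
        subst this; omega
    apply Finset.card_lt_card
    rw [Finset.ssubset_iff_of_subset]
    · refine ⟨i, ?_, ?_⟩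
      · rw [Finset.mem_filter, mem_Des]; exact ⟨⟨by omega, by omega, by omega⟩, hi4, hi3⟩
      · rw [Finset.mem_filter]
        rintro ⟨h1, h2, h3⟩
        have := haft i h1 h2 h3
        omega
    · intro j
      rw [Finset.mem_filter, Finset.mem_filter]
      rintro ⟨h1, h2, h3⟩
      have h4 := haft j h1 h2 h3
      refine ⟨h1, by omega, ?_⟩
      by_contra hcon
      rw [mem_Des] at h1
      exact hav q p j hq1 hlt h4 (by omega) ⟨h3, by omega⟩
  · intro hinv
    by_contra hcon
    have hne : p ≠ q := by rintro rfl; omega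
    have hlt : p < q := by omega
    obtain ⟨m, hm, hmax⟩ := Finset.exists_max_image (Finset.Icc 1 p) (entry σ)
      ⟨p, Finset.mem_Icc.2 ⟨hp1, le_rfl⟩⟩
    rw [Finset.mem_Icc] at hm
    have hpm := hmax p (Finset.mem_Icc.2 ⟨hp1, le_rfl⟩)
    have hmq : entry σ m < entry σ q := by
      by_contra h
      have h1 : entry σ m ≠ entry σ q := fun h2 => by
        have := entry_inj σ (by omega) (by omega) (by omega) (by omega) h2
        omega
      have h2 : m ≠ p := by rintro rfl; omega
      exact hav m p q hm.1 (by omega) hlt hqn ⟨hpq, by omega⟩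
    have h1 := hinv.2 _ hpm hmq
    rw [hgt_perm, kht_perm, Nat.cast_lt] at h1
    refine absurd (Finset.card_le_card ?_) (not_le.2 h1)
    intro j
    rw [Finset.mem_filter, Finset.mem_filter]
    rintro ⟨h1, h2, h3⟩
    refine ⟨h1, ?_, by omega⟩
    rw [mem_Des] at h1
    have hpj : p < j := by
      by_contra h
      have := hmax j (Finset.mem_Icc.2 ⟨by omega, by omega⟩)
      omega
    by_contra h
    have e1 : entry σ (j + 1) ≠ entry σ p := fun h2 => by
      have := entry_inj σ (by omega) (by omega) (by omega) (by omega) h2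
      omega
    have e2 : entry σ (j + 1) ≠ entry σ m := fun h2 => by
      have := entry_inj σ (by omega) (by omega) (by omega) (by omega) h2
      omega
    have e3 : m ≠ p := by rintro rfl; omega
    exact hav m p (j + 1) hm.1 (by omega) (by omega) (by omega) ⟨by omega, by omega⟩

lemma bef_iff {n : ℕ} (σ : Equiv.Perm (Fin n))
    (hav : AvoidsPat (![2, 0, 1] : Fin 3 → Fin 3) σ) {p q : ℕ} (hp1 : 1 ≤ p)
    (hqn : q ≤ n) (hpq : p < q) :
    Bef (Destop σ) (Desbot σ) (entry σ p) (entry σ q) := by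
  rcases Nat.lt_trichotomy (entry σ p) (entry σ q) with h | h | h
  · refine Or.inl ⟨h, fun h' => ?_⟩
    rw [← inv_iff σ hav (by omega) (by omega) (by omega) (by omega) h] at h'
    omega
  · have := entry_inj σ (by omega) (by omega) (by omega) (by omega) h
    omega
  · exact Or.inr ((inv_iff σ hav (by omega) (by omega) (by omega) (by omega) h).1 hpq)

lemma perm_unique {n : ℕ} (σ τ : Equiv.Perm (Fin n)) (T B : Finset ℕ)
    (hσ : ∀ i j : Fin n, i < j → Bef T B (σ i + 1) (σ j + 1))
    (hτ : ∀ i j : Fin n, i < j → Bef T B (τ i + 1) (τ j + 1)) : σ = τ := by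
  have hmono : StrictMono (σ.trans τ.symm) := by
    intro i j hij
    by_contra hcon
    have h1 := hσ i j hij
    rcases lt_or_eq_of_le (not_lt.1 hcon) with h | h
    · have h2 := hτ _ _ h
      simp only [Equiv.trans_apply, Equiv.apply_symm_apply] at h2
      exact h1.asymm h2
    · have := (σ.trans τ.symm).injective h
      omega
  have hid : ⇑(σ.trans τ.symm) = id := by
    apply (StrictMono.range_inj hmono strictMono_id).1
    rw [(σ.trans τ.symm).surjective.range_eq, Set.range_id]
  ext i
  have := congrFun hid i
  simp only [Equiv.trans_apply, id] at this
  rw [Equiv.symm_apply_eq] at this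
  rw [this]

lemma exists_perm (n : ℕ) (T B : Finset ℕ) : ∃ σ : Equiv.Perm (Fin n),
    ∀ i j : Fin n, i < j → Bef T B (σ i + 1) (σ j + 1) := by
  let S : Fin n → Finset (Fin n) := fun a => Finset.univ.filter (fun c => Bef T B (c + 1) (a + 1))
  have hS : ∀ a, (S a).card < n := by
    intro a
    have : (S a).card < (Finset.univ : Finset (Fin n)).card := by
      apply Finset.card_lt_card
      rw [Finset.ssubset_iff_of_subset (Finset.subset_univ _)]
      refine ⟨a, Finset.mem_univ _, fun h => ?_⟩
      exact (Finset.mem_filter.1 h).2.irrefl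
    simpa using this
  let pos : Fin n → Fin n := fun a => ⟨(S a).card, hS a⟩
  have hpos : ∀ a c : Fin n, Bef T B (a + 1) (c + 1) → pos a < pos c := by
    intro a c h
    change (S a).card < (S c).card
    apply Finset.card_lt_card
    rw [Finset.ssubset_iff_of_subset]
    · refine ⟨a, Finset.mem_filter.2 ⟨Finset.mem_univ _, h⟩, fun h => ?_⟩
      exact (Finset.mem_filter.1 h).2.irrefl
    · intro x hx
      exact Finset.mem_filter.2 ⟨Finset.mem_univ _, (Finset.mem_filter.1 hx).2.trans h⟩
  have hinj : Function.Injective pos := by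
    intro a c h
    by_contra hne
    rcases Bef.total (T := T) (B := B) (a := a + 1) (c := c + 1) (by omega) with h' | h'
    · exact absurd h (hpos _ _ h').ne
    · exact absurd h (hpos _ _ h').ne'
  let e : Equiv.Perm (Fin n) := Equiv.ofBijective pos (Finite.injective_iff_bijective.1 hinj)
  have he : ∀ i, pos (e.symm i) = i := fun i => e.apply_symm_apply i
  refine ⟨e.symm, fun i j hij => ?_⟩
  have hne : e.symm i ≠ e.symm j := fun h => by
    have := e.symm.injective h
    omega
  rcases Bef.total (T := T) (B := B) (a := (e.symm i : ℕ) + 1) (c := (e.symm j : ℕ) + 1)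
    (by omega) with h | h
  · exact h
  · have := hpos _ _ h
    rw [he, he] at this
    omega

section Existence
variable {n : ℕ} {T B : Finset ℕ} (σ : Equiv.Perm (Fin n))

lemma av_of_bef (hbef : ∀ i j, 1 ≤ i → i < j → j ≤ n → Bef T B (entry σ i) (entry σ j)) :
    AvoidsPat (![2, 0, 1] : Fin 3 → Fin 3) σ := by
  rw [avoids_iff]
  rintro i j k hi hij hjk hk ⟨h1, h2⟩
  have b1 := hbef i j hi hij (by omega)
  have b2 := hbef j k (by omega) hjk hk
  rcases b1 with b1 | b1
  · omega
  · exact b2.asymm (Or.inr (b1.cotrans h1 h2))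

lemma lt_of_bef (hbef : ∀ i j, 1 ≤ i → i < j → j ≤ n → Bef T B (entry σ i) (entry σ j))
    {i j : ℕ} (hi : i ≤ n) (hj : 1 ≤ j) (h : Bef T B (entry σ i) (entry σ j)) : i < j := by
  rcases Nat.lt_trichotomy i j with h' | h' | h'
  · exact h'
  · subst h'; exact h.irrefl.elim
  · exact (h.asymm (hbef j i hj h' hi)).elim

lemma desbot_of_bef (hd : DescentMatching T B) (hn : ∀ t ∈ T, t ≤ n)
    (hbef : ∀ i j, 1 ≤ i → i < j → j ≤ n → Bef T B (entry σ i) (entry σ j)) :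
    Desbot σ = B := by
  ext v
  unfold Desbot
  simp only [Finset.mem_image, mem_Des]
  constructor
  · rintro ⟨i, ⟨h1, h2, h3⟩, rfl⟩
    rcases hbef i (i + 1) h1 (by omega) h2 with h | h
    · omega
    · exact bot_of_inv h
  · intro hv
    have hvn := bot_lt hd hn v hv
    have hv0 := hd.2.2.1 v hv
    obtain ⟨p, hp1, hpn, hpv⟩ := entry_surj σ (v := v) hv0 hvn.le
    obtain ⟨q, hq1, hqn, hqv⟩ := entry_surj σ (v := v + 1) (by omega) hvn
    have hI := inv_of_bot (T := T) hv
    have hqp : q < p := lt_of_bef σ hbef hqn hp1 (by rw [hpv, hqv]; exact Or.inr hI)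
    obtain ⟨r, rfl⟩ : ∃ r, p = r + 1 := ⟨p - 1, by omega⟩
    refine ⟨r, ⟨by omega, hpn, ?_⟩, hpv⟩
    by_contra hcon
    have hne : entry σ r ≠ entry σ (r + 1) := fun h => by
      have := entry_inj σ (by omega) (by omega) (by omega) (by omega) h
      omega
    have hqr : q ≠ r := by rintro rfl; omega
    have b := hbef q r hq1 (by omega) (by omega)
    rcases b with b | b
    · omega
    · rw [hqv] at b
      have b2 := b.cotrans (c := v) (by omega) (by omega)
      rw [← hpv] at b2
      exact (hbef r (r + 1) (by omega) (by omega) hpn).asymm (Or.inr b2)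

lemma destop_of_bef (hd : DescentMatching T B) (hn : ∀ t ∈ T, t ≤ n)
    (hbef : ∀ i j, 1 ≤ i → i < j → j ≤ n → Bef T B (entry σ i) (entry σ j)) :
    Destop σ = T := by
  symm
  apply Finset.eq_of_subset_of_card_le
  · intro v hv
    unfold Destop
    simp only [Finset.mem_image, mem_Des]
    obtain ⟨a, haB, hI, hk⟩ := top_partner hd hv
    obtain ⟨p, hp1, hpn, hpv⟩ := entry_surj σ (v := v) (hd.2.1 v hv) (hn v hv)
    obtain ⟨q, hq1, hqn, hqv⟩ := entry_surj σ (v := a) (hd.2.2.1 a haB) (bot_lt hd hn a haB).le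
    have hpq : p < q := lt_of_bef σ hbef hpn hq1 (by rw [hpv, hqv]; exact Or.inr hI)
    refine ⟨p, ⟨hp1, by omega, ?_⟩, hpv⟩
    by_contra hcon
    have hne : entry σ p ≠ entry σ (p + 1) := fun h => by
      have := entry_inj σ (by omega) (by omega) (by omega) (by omega) h
      omega
    have hav := hI.1
    have hqr : q ≠ p + 1 := by rintro rfl; omega
    have b := hbef (p + 1) q (by omega) (by omega) (by omega)
    rcases b with b | b
    · omega
    · refine (hbef p (p + 1) (by omega) (by omega) (by omega)).asymm (Or.inr ⟨by omega, ?_⟩)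
      intro x hx1 hx2
      have := b.2 x (by omega) hx2
      rw [hqv, hk] at this
      rwa [hpv]
  · have h1 := card_filter_top σ (fun _ => True)
    have h2 := card_filter_bot σ (fun _ => True)
    simp only [Finset.filter_true] at h1 h2
    rw [h1, ← h2, desbot_of_bef σ hd hn hbef, hd.1]

end Existence

/-- For any descent matching `(T, B)` and any `n ≥ max T` (arbitrary `n ≥ 0`
if `T = ∅`), there is a unique `σ ∈ Av_n(312)` with `Destop σ = T` and `Desbot σ = B`. -/
theorem exists_unique_av312_of_descentMatching (T B : Finset ℕ) (h : DescentMatching T B)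
    (n : ℕ) (hn : ∀ t ∈ T, t ≤ n) :
    ∃! σ : Equiv.Perm (Fin n),
      AvoidsPat (![2, 0, 1] : Fin 3 → Fin 3) σ ∧ Destop σ = T ∧ Desbot σ = B := by
  obtain ⟨σ, hσ⟩ := exists_perm n T B
  have hbef : ∀ i j, 1 ≤ i → i < j → j ≤ n → Bef T B (entry σ i) (entry σ j) := by
    intro i j h1 h2 h3
    rw [entry_eq' σ h1 (by omega), entry_eq' σ (by omega) h3]
    exact hσ _ _ (by rw [Fin.lt_def]; simp only; omega)
  refine ⟨σ, ⟨av_of_bef σ hbef, destop_of_bef σ h hn hbef, desbot_of_bef σ h hn hbef⟩, ?_⟩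
  rintro τ ⟨hav, hT, hB⟩
  refine perm_unique τ σ T B (fun i j hij => ?_) hσ
  have := bef_iff τ hav (p := i + 1) (q := j + 1) (by omega) j.2 (by omega)
  rwa [entry_eq, entry_eq, hT, hB] at this
end

section
/- Let n ≥ 0 and let (T, B) be a descent matching with T ⊆ [n]. Then, in the polynomial ring in the 2n variables p_1,…,p_n, q_1,…,q_n over the integers (or in any commutative ring), Σ_{σ ∈ S_n, Destop(σ)=T, Desbot(σ)=B} Π_{i=1}^{n} p_i^{(2_i31)σ} q_i^{(31 2_i)σ} = Π_{i=1}^{n} [sg_{n,(T,B)}(i)]_{p_i,q_i}. -/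
open scoped Classical

namespace DT

/-- automaton: is `j` preceded by something larger -/
def fB (j : ℕ) : Bool → List ℕ → Bool
  | _, [] => false
  | b, x :: l => if x = j then b else fB j (decide (j < x)) l

/-- automaton: is `j` followed by something smaller -/
def fT (j : ℕ) : Bool → List ℕ → Bool
  | _, [] => false
  | c, x :: l => (c && decide (x < j)) || fT j (decide (x = j)) l

/-- number of descents crossing `j` -/
def fC (j : ℕ) : Bool → List ℕ → ℕ
  | _, [] => 0
  | b, x :: l => (if b = true ∧ x < j then 1 else 0) + fC j (decide (j < x)) l

/-- number of descents crossing `j` to the right of `j` -/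
def fD (j : ℕ) : List ℕ → ℕ
  | [] => 0
  | x :: l => if x = j then fC j false l else fD j l

theorem fB_high (j : ℕ) (r V : List ℕ) (hr : ∀ x ∈ r, j < x) :
    fB j true (r ++ V) = fB j true V := by
  induction r with
  | nil => rfl
  | cons x r ih =>
    have hx := hr x (by simp)
    simp only [List.cons_append, fB, if_neg hx.ne', hx, decide_true]
    exact ih (fun y hy => hr y (by simp [hy]))

theorem fT_high (j : ℕ) (r V : List ℕ) (hr : ∀ x ∈ r, j < x) :
    fT j false (r ++ V) = fT j false V := by
  induction r with
  | nil => rfl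
  | cons x r ih =>
    have hx := hr x (by simp)
    simp only [List.cons_append, fT, hx.ne', decide_false, Bool.false_and, Bool.false_or]
    exact ih (fun y hy => hr y (by simp [hy]))

theorem fC_high (j : ℕ) (r V : List ℕ) (hr : ∀ x ∈ r, j < x) :
    fC j true (r ++ V) = fC j true V := by
  induction r with
  | nil => rfl
  | cons x r ih =>
    have hx := hr x (by simp)
    simp only [List.cons_append, fC, hx, not_lt.2 hx.le, decide_true, and_false, if_false, zero_add]
    exact ih (fun y hy => hr y (by simp [hy]))

theorem fD_high (j : ℕ) (r V : List ℕ) (hr : ∀ x ∈ r, j < x) :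
    fD j (r ++ V) = fD j V := by
  induction r with
  | nil => rfl
  | cons x r ih =>
    have hx := hr x (by simp)
    simp only [List.cons_append, fD, if_neg hx.ne']
    exact ih (fun y hy => hr y (by simp [hy]))

theorem fB_rep (j N x : ℕ) (r V : List ℕ) (hN : j < N) (hx : j < x) (hr : ∀ x ∈ r, j < x) 
    (A : List ℕ) (b : Bool) : fB j b (A ++ (x :: r ++ V)) = fB j b (A ++ N :: V) := by
  induction A generalizing b with
  | nil => simp only [List.nil_append, List.cons_append, fB, hN, hx, hN.ne', hx.ne', decide_true,
      if_false]; exact fB_high j r V hr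
  | cons y A ih => simp only [List.cons_append, fB] at ih ⊢; rw [ih]

theorem fT_rep (j N x : ℕ) (r V : List ℕ) (hN : j < N) (hx : j < x) (hr : ∀ x ∈ r, j < x) 
    (A : List ℕ) (b : Bool) : fT j b (A ++ (x :: r ++ V)) = fT j b (A ++ N :: V) := by
  induction A generalizing b with
  | nil => simp only [List.nil_append, List.cons_append, fT, not_lt.2 hN.le, not_lt.2 hx.le,
      hN.ne', hx.ne', decide_false]; rw [fT_high j r V hr]
  | cons y A ih => simp only [List.cons_append, fT] at ih ⊢; rw [ih]

theorem fC_rep (j N x : ℕ) (r V : List ℕ) (hN : j < N) (hx : j < x) (hr : ∀ x ∈ r, j < x) 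
    (A : List ℕ) (b : Bool) : fC j b (A ++ (x :: r ++ V)) = fC j b (A ++ N :: V) := by
  induction A generalizing b with
  | nil => simp only [List.nil_append, List.cons_append, fC, not_lt.2 hN.le, not_lt.2 hx.le,
      hN, hx, decide_true, and_false, if_false]; rw [fC_high j r V hr]
  | cons y A ih => simp only [List.cons_append, fC] at ih ⊢; rw [ih]

theorem fD_rep (j N x : ℕ) (r V : List ℕ) (hN : j < N) (hx : j < x) (hr : ∀ x ∈ r, j < x) 
    (A : List ℕ) : fD j (A ++ (x :: r ++ V)) = fD j (A ++ N :: V) := by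
  induction A with
  | nil => simp only [List.nil_append, List.cons_append, fD,
      hN.ne', hx.ne', if_false]; rw [fD_high j r V hr]
  | cons y A ih =>
    simp only [List.cons_append, fD]
    rw [← List.cons_append, ih, fC_rep j N x r V hN hx hr]

/-- evaluation at the unique occurrence -/
theorem fB_eval (j : ℕ) (U V : List ℕ) (hU : j ∉ U) (b : Bool) :
    fB j b (U ++ j :: V) = (match U.getLast? with | none => b | some x => decide (j < x)) := by
  induction U generalizing b with
  | nil => simp [fB]
  | cons y U ih =>
    simp only [List.mem_cons, not_or] at hU
    simp only [List.cons_append, fB, if_neg (Ne.symm hU.1)]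
    rw [ih hU.2]
    cases U with
    | nil => simp
    | cons z U => 
      rw [List.getLast?_cons_cons]
      cases h : (z :: U).getLast? with
      | none => simp at h
      | some x => rfl

theorem fT_none (j : ℕ) (V : List ℕ) (hV : j ∉ V) : fT j false V = false := by
  induction V with
  | nil => rfl
  | cons y V ih =>
    simp only [List.mem_cons, not_or] at hV
    simp [fT, Ne.symm hV.1, ih hV.2]

theorem fT_eval (j : ℕ) (U V : List ℕ) (hU : j ∉ U) (hV : j ∉ V) :
    fT j false (U ++ j :: V) = (match V.head? with | none => false | some x => decide (x < j)) := by
  induction U with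
  | nil =>
    cases V with
    | nil => simp [fT]
    | cons y V =>
      simp only [List.mem_cons, not_or] at hV
      simp [fT, Ne.symm hV.1, fT_none j V hV.2]
  | cons y U ih =>
    simp only [List.mem_cons, not_or] at hU
    simp only [List.cons_append, fT, Ne.symm hU.1, decide_false, Bool.false_and, Bool.false_or]
    exact ih hU.2

theorem fD_eval (j : ℕ) (U V : List ℕ) (hU : j ∉ U) :
    fD j (U ++ j :: V) = fC j false V := by
  induction U with
  | nil => simp [fD]
  | cons y U ih =>
    simp only [List.mem_cons, not_or] at hU
    simp only [List.cons_append, fD, if_neg (Ne.symm hU.1)]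
    exact ih hU.2

/-- no two adjacent `N` -/
def NN (N : ℕ) (W : List ℕ) : Prop := List.IsChain (fun x y => ¬ (x = N ∧ y = N)) W

theorem fC_true (v y : ℕ) (l : List ℕ) (h : y < v) :
    fC v true (y :: l) = 1 + fC v false (y :: l) := by
  simp [fC, h]

theorem fC_count (N v : ℕ) (hv : v < N) (V0 : List ℕ)
    (hV : ∀ x ∈ V0, x = N ∨ x < v) (hN : NN N (V0 ++ [N])) :
    fC v false (V0 ++ [N]) + 1 = (V0 ++ [N]).count N := by
  induction V0 with
  | nil => simp [fC]
  | cons x V0 ih =>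
    have hN' : NN N (V0 ++ [N]) := by
      unfold NN at *; rw [List.cons_append] at hN; exact hN.tail
    have ih' := ih (fun y hy => hV y (by simp [hy])) hN'
    rcases hV x (by simp) with h | h
    · cases V0 with
      | nil => simp [NN, h] at hN
      | cons y V0 =>
        simp only [NN, List.cons_append, List.isChain_cons_cons] at hN
        have hy : y < v := by
          rcases hV y (by simp) with h' | h'
          · exact absurd ⟨h, h'⟩ hN.1
          · exact h'
        rw [List.cons_append, h, List.count_cons_self, ← ih', List.cons_append]
        have := fC_true v y (V0 ++ [N]) hy
        conv_lhs => unfold fC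
        simp only [hv, decide_true]
        rw [this]
        simp; omega
    · have h2 : x ≠ N := by omega
      rw [List.cons_append, List.count_cons_of_ne h2, ← ih']
      conv_lhs => unfold fC
      simp [not_lt.2 h.le]

theorem split_exists (N : ℕ) (W : List ℕ) (c : ℕ) (h : c < W.count N) :
    ∃ U V, W = U ++ N :: V ∧ V.count N = c := by
  induction W with
  | nil => simp at h
  | cons x W ih =>
    by_cases hc : c < W.count N
    · obtain ⟨U, V, rfl, hV⟩ := ih hc
      exact ⟨x :: U, V, rfl, hV⟩
    · by_cases hx : x = N
      · subst hx
        simp at h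
        exact ⟨[], W, rfl, by omega⟩
      · rw [List.count_cons_of_ne hx] at h
        omega

theorem split_unique (N : ℕ) (U V U' V' : List ℕ) (h : U ++ N :: V = U' ++ N :: V')
    (hc : V.count N = V'.count N) : U = U' ∧ V = V' := by
  rw [List.append_eq_append_iff] at h
  rcases h with ⟨X, h1, h2⟩ | ⟨X, h1, h2⟩
  · cases X with
    | nil => simp at h1 h2; simp [h1, h2]
    | cons y X =>
      simp at h2
      rw [h2.2] at hc; simp at hc; omega
  · cases X with
    | nil => simp at h1 h2; simp [h1, h2]
    | cons y X =>
      simp at h2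
      rw [h2.2] at hc; simp at hc; omega

/-- Stats of the letter `j` in the word `W`. -/
def St (T B : Finset ℕ) (a : ℕ → ℕ) (W : List ℕ) (j : ℕ) : Prop :=
  fB j false W = decide (j ∈ B) ∧ fT j false W = decide (j ∈ T) ∧ fD j W = a j

structure Good (N : ℕ) (T B : Finset ℕ) (a : ℕ → ℕ) (v : ℕ) (W : List ℕ) : Prop where
  cnt : ∀ j, 1 ≤ j → j ≤ v → W.count j = 1
  mem : ∀ x ∈ W, x = N ∨ (1 ≤ x ∧ x ≤ v)
  last : ∃ W0, W = W0 ++ [N]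
  nn : NN N W
  cntN : W.count N + (T.filter (fun t => t ≤ v)).card = (B.filter (fun t => t ≤ v)).card + 1
  st : ∀ j, 1 ≤ j → j ≤ v → St T B a W j

/-- replacement word -/
noncomputable def rp (N : ℕ) (T B : Finset ℕ) (v : ℕ) : List ℕ :=
  (if v ∈ B then [N] else []) ++ v :: (if v ∈ T then [] else [N])

theorem St_rep (N : ℕ) (T B : Finset ℕ) (a : ℕ → ℕ) (v j : ℕ) (hN : v < N) (hj : j < v)
    (U V : List ℕ) : St T B a (U ++ rp N T B v ++ V) j ↔ St T B a (U ++ N :: V) j := by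
  have hr : ∀ x ∈ rp N T B v, j < x := by
    intro x hx
    simp only [rp, List.mem_append, List.mem_cons] at hx
    rcases hx with h | h | h
    · split_ifs at h <;> simp at h; omega
    · omega
    · split_ifs at h <;> simp at h; omega
  have hne : rp N T B v ≠ [] := by simp [rp]
  obtain ⟨x, r, h⟩ := List.exists_cons_of_ne_nil hne
  rw [h] at hr ⊢
  have hx := hr x (by simp)
  have hr' : ∀ y ∈ r, j < y := fun y hy => hr y (by simp [hy])
  have hjN : j < N := by omega
  rw [List.append_assoc]
  unfold St
  rw [fB_rep j N x r V hjN hx hr', fT_rep j N x r V hjN hx hr', fD_rep j N x r V hjN hx hr']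

theorem card_le_succ (T : Finset ℕ) (v : ℕ) :
    (T.filter (fun t => t ≤ v + 1)).card =
      (T.filter (fun t => t ≤ v)).card + if v + 1 ∈ T then 1 else 0 := by
  have : T.filter (fun t => t ≤ v + 1) = T.filter (fun t => t ≤ v) ∪ T.filter (fun t => t = v + 1) := by
    ext x; simp; grind
  rw [this, Finset.card_union_of_disjoint]
  · congr 1
    rw [Finset.filter_eq']
    split_ifs <;> simp
  · rw [Finset.disjoint_filter]; intro x _ h; omega

theorem count_rp (N : ℕ) (T B : Finset ℕ) (v j : ℕ) : (rp N T B v).count j =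
    (if v ∈ B then if N = j then 1 else 0 else 0) + (if v = j then 1 else 0) +
    (if v ∈ T then 0 else if N = j then 1 else 0) := by
  unfold rp
  split_ifs <;> simp_all

theorem NN_append (N : ℕ) (X Y : List ℕ) : NN N (X ++ Y) ↔ NN N X ∧ NN N Y ∧
    ¬ (X.getLast? = some N ∧ Y.head? = some N) := by
  unfold NN
  rw [List.isChain_append]
  apply and_congr_right'
  apply and_congr_right'
  constructor
  · rintro h ⟨h1, h2⟩
    exact h N h1 N h2 ⟨rfl, rfl⟩
  · rintro h x hx y hy ⟨rfl, rfl⟩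
    exact h ⟨hx, hy⟩

theorem NN_cons (N x : ℕ) (Y : List ℕ) : NN N (x :: Y) ↔ NN N Y ∧
    ¬ (x = N ∧ Y.head? = some N) := by
  have := NN_append N [x] Y
  simpa [NN] using this

theorem NN_nil (N : ℕ) : NN N [] := by simp [NN]

theorem good_up (N : ℕ) (T B : Finset ℕ) (a : ℕ → ℕ) (v : ℕ) (hv : v + 1 < N) (U V : List ℕ)
   (hg : Good N T B a v (U ++ N :: V)) (hc : V.count N = a (v + 1) + if v + 1 ∈ T then 1 else 0) :
   Good N T B a (v + 1) (U ++ rp N T B (v + 1) ++ V) := by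
  obtain ⟨cnt, mem, last, nn, cntN, st⟩ := hg
  have hvU : v + 1 ∉ U := fun h => by
    rcases mem (v+1) (by simp [h]) with h | h <;> omega
  have hvV : v + 1 ∉ V := fun h => by
    rcases mem (v+1) (by simp [h]) with h | h <;> omega
  have hlast : V = [] ∨ ∃ V0, V = V0 ++ [N] := by
    obtain ⟨W0, hW⟩ := last
    rcases List.eq_nil_or_concat V with h | ⟨V0, y, h⟩
    · exact Or.inl h
    · right
      rw [h] at hW
      have : (U ++ N :: V0) ++ [y] = W0 ++ [N] := by simpa using hW
      have := (List.append_inj' this rfl).2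
      exact ⟨V0, by rw [h]; simpa using this⟩
  have hTV : v + 1 ∈ T → V ≠ [] := by
    rintro h rfl
    simp [h] at hc
  rw [NN_append, NN_cons] at nn
  obtain ⟨nU, ⟨nV, hVh⟩, hUl⟩ := nn
  simp only [List.head?_cons, and_true, true_and] at hVh hUl
  have memU : ∀ x ∈ U, x = N ∨ 1 ≤ x ∧ x ≤ v := fun x hx => mem x (by simp [hx])
  have memV : ∀ x ∈ V, x = N ∨ 1 ≤ x ∧ x ≤ v := fun x hx => mem x (by simp [hx])
  -- the part after `v+1`
  set Z : List ℕ := (if v + 1 ∈ T then [] else [N]) ++ V with hZ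
  set Y : List ℕ := U ++ (if v + 1 ∈ B then [N] else []) with hY
  have hW : U ++ rp N T B (v + 1) ++ V = Y ++ (v + 1) :: Z := by
    simp [rp, hZ, hY]
  have nZ : NN N Z := by
    rw [hZ]; split_ifs
    · simpa using nV
    · simp only [List.cons_append, List.nil_append, NN_cons]
      exact ⟨nV, by simpa using hVh⟩
  have nY : NN N Y := by
    rw [hY]; split_ifs
    · rw [NN_append]
      exact ⟨nU, by simp [NN], by simpa using hUl⟩
    · simpa using nU
  have lZ : ∃ Z0, Z = Z0 ++ [N] := by
    rcases hlast with h | ⟨V0, h⟩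
    · have : v + 1 ∉ T := fun h' => hTV h' h
      exact ⟨[], by simp [hZ, h, this]⟩
    · exact ⟨_, by rw [hZ, h, ← List.append_assoc]⟩
  have memZ : ∀ x ∈ Z, x = N ∨ 1 ≤ x ∧ x ≤ v := by
    intro x hx
    rw [hZ, List.mem_append] at hx
    rcases hx with h | h
    · split_ifs at h <;> simp at h; exact Or.inl h
    · exact memV x h
  have memY : ∀ x ∈ Y, x = N ∨ 1 ≤ x ∧ x ≤ v := by
    intro x hx
    rw [hY, List.mem_append] at hx
    rcases hx with h | h
    · exact memU x h
    · split_ifs at h <;> simp at h; exact Or.inl h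
  have hvY : v + 1 ∉ Y := fun h => by
    rcases memY _ h with h | h <;> omega
  have hvZ : v + 1 ∉ Z := fun h => by
    rcases memZ _ h with h | h <;> omega
  have cZ : Z.count N = a (v + 1) + 1 := by
    rw [hZ, List.count_append, hc]; split_ifs <;> simp; omega
  refine ⟨?_, ?_, ?_, ?_, ?_, ?_⟩
  · intro j h1 h2
    have hjN : N ≠ j := by omega
    simp only [List.count_append, count_rp, hjN, if_false, ite_self]
    by_cases hj : j = v + 1
    · subst hj
      simp [List.count_eq_zero_of_not_mem hvU, List.count_eq_zero_of_not_mem hvV]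
    · have := cnt j h1 (by omega)
      rw [List.count_append, List.count_cons_of_ne hjN] at this
      rw [if_neg (Ne.symm hj)]; omega
  · intro x hx
    rw [hW, List.mem_append, List.mem_cons] at hx
    rcases hx with h | h | h
    · rcases memY x h with h | h
      · exact Or.inl h
      · right; omega
    · right; omega
    · rcases memZ x h with h | h
      · exact Or.inl h
      · right; omega
  · obtain ⟨Z0, h⟩ := lZ
    exact ⟨Y ++ (v + 1) :: Z0, by rw [hW, h]; simp⟩
  · rw [hW, NN_append, NN_cons]
    have : v + 1 ≠ N := by omega
    exact ⟨nY, ⟨nZ, by simp [this]⟩, by simp [this]⟩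
  · rw [card_le_succ T, card_le_succ B]
    simp only [List.count_append, count_rp, List.count_cons_self] at cntN ⊢
    have : v + 1 ≠ N := by omega
    simp only [this, if_true, if_false]
    split_ifs <;> omega
  · intro j h1 h2
    by_cases hj : j = v + 1
    · subst hj
      rw [hW]
      refine ⟨?_, ?_, ?_⟩
      · rw [fB_eval _ _ _ hvY, hY]
        by_cases hB : v + 1 ∈ B
        · simp [hB, hv]
        · simp only [hB, if_false, List.append_nil, decide_false]
          cases h : U.getLast? with
          | none => rfl
          | some x =>
            have hx : x ∈ U := List.mem_of_getLast? h
            rcases memU x hx with h' | h'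
            · rw [h, h'] at hUl; simp at hUl
            · simp; omega
      · rw [fT_eval _ _ _ hvY hvZ, hZ]
        by_cases hT : v + 1 ∈ T
        · simp only [hT, if_true, List.nil_append, decide_true]
          obtain ⟨y, V1, h⟩ := List.exists_cons_of_ne_nil (hTV hT)
          rw [h]
          rcases memV y (by simp [h]) with h' | h'
          · rw [h, h'] at hVh; simp at hVh
          · simp; omega
        · simp [hT]; omega
      · rw [fD_eval _ _ _ hvY]
        obtain ⟨Z0, h⟩ := lZ
        have := fC_count N (v+1) hv Z0 (fun x hx => by
          rcases memZ x (by simp [h, hx]) with h | h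
          · exact Or.inl h
          · right; omega) (h ▸ nZ)
        rw [← h, cZ] at this
        omega
    · rw [St_rep _ _ _ _ _ _ hv (by omega)]
      exact st j h1 (by omega)

theorem good_down (N : ℕ) (T B : Finset ℕ) (a : ℕ → ℕ) (v : ℕ) (hv : v + 1 < N) (W : List ℕ)
   (hg : Good N T B a (v + 1) W) : ∃ U V, W = U ++ rp N T B (v + 1) ++ V ∧
    Good N T B a v (U ++ N :: V) ∧ V.count N = a (v + 1) + if v + 1 ∈ T then 1 else 0 := by
  obtain ⟨cnt, mem, last, nn, cntN, st⟩ := hg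
  have c1 := cnt (v + 1) (by omega) le_rfl
  obtain ⟨Y, Z, hW, hZ0⟩ := split_exists (v + 1) W 0 (by omega)
  have hvZ : v + 1 ∉ Z := List.count_eq_zero.1 hZ0
  have hvY : v + 1 ∉ Y := by
    rw [hW, List.count_append, List.count_cons_self] at c1
    exact List.count_eq_zero.1 (by omega)
  have memY : ∀ x ∈ Y, x = N ∨ 1 ≤ x ∧ x ≤ v := by
    intro x hx
    have : x ≠ v + 1 := by rintro rfl; exact hvY hx
    have := mem x (by simp [hW, hx])
    omega
  have memZ : ∀ x ∈ Z, x = N ∨ 1 ≤ x ∧ x ≤ v := by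
    intro x hx
    have : x ≠ v + 1 := by rintro rfl; exact hvZ hx
    have := mem x (by simp [hW, hx])
    omega
  have lZ : ∃ Z0, Z = Z0 ++ [N] := by
    obtain ⟨W0, hW0⟩ := last
    rw [hW] at hW0
    rcases List.eq_nil_or_concat Z with h | ⟨V0, y, h⟩
    · rw [h] at hW0
      have := (List.append_inj' hW0 rfl).2
      simp at this; omega
    · rw [h] at hW0
      have : (Y ++ (v + 1) :: V0) ++ [y] = W0 ++ [N] := by simpa using hW0
      have := (List.append_inj' this rfl).2
      exact ⟨V0, by rw [h]; simpa using this⟩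
  have nn' := nn
  rw [hW, NN_append, NN_cons] at nn'
  obtain ⟨nY, ⟨nZ, -⟩, -⟩ := nn'
  obtain ⟨sB, sT, sD⟩ := st (v + 1) (by omega) le_rfl
  rw [hW, fB_eval _ _ _ hvY] at sB
  rw [hW, fT_eval _ _ _ hvY hvZ] at sT
  rw [hW, fD_eval _ _ _ hvY] at sD
  have cZ : Z.count N = a (v + 1) + 1 := by
    obtain ⟨Z0, h⟩ := lZ
    have := fC_count N (v+1) hv Z0 (fun x hx => by
          rcases memZ x (by simp [h, hx]) with h | h
          · exact Or.inl h
          · right; omega) (h ▸ nZ)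
    rw [← h] at this
    omega
  obtain ⟨U, hU, hUl⟩ : ∃ U, Y = U ++ (if v + 1 ∈ B then [N] else []) ∧ U.getLast? ≠ some N := by
    by_cases hB : v + 1 ∈ B
    · simp only [hB, if_true, decide_true] at sB ⊢
      rcases List.eq_nil_or_concat Y with h | ⟨V0, y, h⟩
      · simp [h] at sB
      · have hy : y = N := by
          rw [h] at sB; simp at sB
          have := memY y (by simp [h])
          omega
        subst hy
        refine ⟨V0, by simpa using h, fun h' => ?_⟩
        rw [h, List.concat_eq_append, NN_append] at nY
        simp [h'] at nY
    · simp only [hB, if_false, decide_false] at sB ⊢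
      refine ⟨Y, by simp, fun h => ?_⟩
      rw [h] at sB; simp at sB; omega
  obtain ⟨V, hV, hVh⟩ : ∃ V, Z = (if v + 1 ∈ T then [] else [N]) ++ V ∧ V.head? ≠ some N := by
    obtain ⟨y, V0, h⟩ : ∃ y V0, Z = y :: V0 := by
      apply List.exists_cons_of_ne_nil
      obtain ⟨Z0, h⟩ := lZ
      simp [h]
    by_cases hT : v + 1 ∈ T
    · simp only [hT, if_true, decide_true] at sT ⊢
      refine ⟨Z, by simp, fun h' => ?_⟩
      rw [h'] at sT; simp at sT; omega
    · simp only [hT, if_false, decide_false] at sT ⊢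
      have hy : y = N := by
        rw [h] at sT; simp at sT
        have := memZ y (by simp [h])
        omega
      subst hy
      refine ⟨V0, by simpa using h, fun h' => ?_⟩
      rw [h, NN_cons] at nZ
      simp [h'] at nZ
  have hW' : W = U ++ rp N T B (v + 1) ++ V := by
    simp [rp, hW, hU, hV]
  have cV : V.count N = a (v + 1) + if v + 1 ∈ T then 1 else 0 := by
    rw [hV, List.count_append] at cZ
    split_ifs at cZ ⊢ <;> simp at cZ <;> omega
  refine ⟨U, V, hW', ⟨?_, ?_, ?_, ?_, ?_, ?_⟩, cV⟩
  · intro j h1 h2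
    have hjN : N ≠ j := by omega
    have hjv : v + 1 ≠ j := by omega
    have := cnt j h1 (by omega)
    simp only [hW', List.count_append, count_rp, hjN, hjv, if_false, ite_self] at this
    rw [List.count_append, List.count_cons_of_ne hjN]
    omega
  · intro x hx
    rw [List.mem_append, List.mem_cons] at hx
    rcases hx with h | h | h
    · exact memY x (by simp [hU, h])
    · exact Or.inl h
    · exact memZ x (by simp [hV, h])
  · rcases List.eq_nil_or_concat V with h | ⟨V0, y, h⟩
    · exact ⟨U, by rw [h]⟩
    · obtain ⟨Z0, hZ⟩ := lZ
      rw [hV, h, List.concat_eq_append, ← List.append_assoc] at hZ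
      have := (List.append_inj' hZ rfl).2
      simp at this
      exact ⟨U ++ N :: V0, by rw [h, this]; simp⟩
  · rw [NN_append, NN_cons]
    rw [hU, NN_append] at nY
    rw [hV, NN_append] at nZ
    exact ⟨nY.1, ⟨nZ.2.1, by simpa using hVh⟩, by simpa using hUl⟩
  · rw [card_le_succ T, card_le_succ B, hW'] at cntN
    simp only [List.count_append, count_rp, List.count_cons_self] at cntN ⊢
    have : v + 1 ≠ N := by omega
    simp only [this, if_true, if_false] at cntN
    split_ifs at cntN <;> omega
  · intro j h1 h2
    have := st j h1 (by omega)
    rw [hW', St_rep _ _ _ _ _ _ hv (by omega)] at this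
    exact this

theorem good_unique (N : ℕ) (T B : Finset ℕ) (a : ℕ → ℕ) (v : ℕ) (hv : v < N) (W W' : List ℕ)
    (hT : ∀ t ∈ T, 0 < t) (hB : ∀ t ∈ B, 0 < t)
    (h : Good N T B a v W) (h' : Good N T B a v W') : W = W' := by
  induction v generalizing W W' with
  | zero =>
    have key : ∀ W, Good N T B a 0 W → W = [N] := by
      intro W h
      have hall : ∀ x ∈ W, x = N := fun x hx => by
        rcases h.mem x hx with h | h <;> omega
      have := h.cntN
      have e1 : T.filter (fun t => t ≤ 0) = ∅ := by
        ext x; simp; rintro h rfl; exact absurd (hT 0 h) (by simp)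
      have e2 : B.filter (fun t => t ≤ 0) = ∅ := by
        ext x; simp; rintro h rfl; exact absurd (hB 0 h) (by simp)
      rw [e1, e2] at this
      simp at this
      rw [List.eq_replicate_of_mem hall] at this ⊢
      simp at this
      rw [this]; rfl
    rw [key W h, key W' h']
  | succ v ih =>
    obtain ⟨U, V, rfl, hg, hc⟩ := good_down N T B a v hv W h
    obtain ⟨U', V', rfl, hg', hc'⟩ := good_down N T B a v hv W' h'
    obtain ⟨rfl, rfl⟩ := split_unique N U V U' V' (ih (by omega) _ _ hg hg') (by rw [hc, hc'])
    rfl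

theorem good_exists (N : ℕ) (T B : Finset ℕ) (a : ℕ → ℕ) (v : ℕ) (hv : v < N)
    (hT : ∀ t ∈ T, 0 < t) (hB : ∀ t ∈ B, 0 < t)
    (ha : ∀ j, 1 ≤ j → j ≤ v → a j + (T.filter (fun t => t ≤ j)).card ≤ (B.filter (fun t => t < j)).card) :
    ∃ W, Good N T B a v W := by
  induction v with
  | zero =>
    refine ⟨[N], ?_, ?_, ⟨[], rfl⟩, by simp [NN], ?_, ?_⟩
    · intro j h1 h2; omega
    · simp
    · have e1 : T.filter (fun t => t ≤ 0) = ∅ := by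
        ext x; simp; rintro h rfl; exact absurd (hT 0 h) (by simp)
      have e2 : B.filter (fun t => t ≤ 0) = ∅ := by
        ext x; simp; rintro h rfl; exact absurd (hB 0 h) (by simp)
      rw [e1, e2]; simp
    · intro j h1 h2; omega
  | succ v ih =>
    obtain ⟨W, hg⟩ := ih (by omega) (fun j h1 h2 => ha j h1 (by omega))
    have h1 := ha (v + 1) (by omega) le_rfl
    rw [card_le_succ T] at h1
    simp only [Nat.lt_succ_iff] at h1
    have := hg.cntN
    obtain ⟨U, V, rfl, hc⟩ := split_exists N W (a (v + 1) + if v + 1 ∈ T then 1 else 0) (by omega)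
    exact ⟨_, good_up N T B a v hv U V hg hc⟩

end DT

namespace DT

theorem entry_eq {n : ℕ} (σ : Equiv.Perm (Fin n)) (i : ℕ) (h1 : 1 ≤ i) (h2 : i ≤ n) :
    entry σ i = (σ ⟨i - 1, by omega⟩ : ℕ) + 1 := by
  unfold entry; rw [dif_pos]

theorem entry_pos {n : ℕ} (σ : Equiv.Perm (Fin n)) (i : ℕ) (h1 : 1 ≤ i) (h2 : i ≤ n) :
    1 ≤ entry σ i := by
  rw [entry_eq σ i h1 h2]; omega

theorem entry_le {n : ℕ} (σ : Equiv.Perm (Fin n)) (i : ℕ) (h1 : 1 ≤ i) (h2 : i ≤ n) :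
    entry σ i ≤ n := by
  rw [entry_eq σ i h1 h2]; have := (σ ⟨i - 1, by omega⟩).2; omega

theorem entry_inj {n : ℕ} (σ : Equiv.Perm (Fin n)) (i j : ℕ) (h1 : 1 ≤ i) (h2 : i ≤ n)
    (h3 : 1 ≤ j) (h4 : j ≤ n) (h : entry σ i = entry σ j) : i = j := by
  rw [entry_eq σ i h1 h2, entry_eq σ j h3 h4] at h
  have h' := σ.injective (Fin.ext (Nat.succ_injective h))
  simp at h'; omega

theorem entry_surj {n : ℕ} (σ : Equiv.Perm (Fin n)) (v : ℕ) (h1 : 1 ≤ v) (h2 : v ≤ n) :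
    ∃ m, 1 ≤ m ∧ m ≤ n ∧ entry σ m = v := by
  obtain ⟨x, hx⟩ := σ.surjective ⟨v - 1, by omega⟩
  refine ⟨x + 1, by omega, x.2, ?_⟩
  rw [entry_eq σ _ (by omega) x.2]
  simp [hx]; omega

theorem mem_Des {n : ℕ} (σ : Equiv.Perm (Fin n)) (i : ℕ) :
    i ∈ Des σ ↔ 1 ≤ i ∧ i + 1 ≤ n ∧ entry σ (i + 1) < entry σ i := by
  simp only [Des, Finset.mem_filter, Finset.mem_Icc]
  grind

theorem mem_Destop {n : ℕ} (σ : Equiv.Perm (Fin n)) (m : ℕ) (h1 : 1 ≤ m) (h2 : m ≤ n) :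
    entry σ m ∈ Destop σ ↔ m + 1 ≤ n ∧ entry σ (m + 1) < entry σ m := by
  simp only [Destop, Finset.mem_image, mem_Des]
  constructor
  · rintro ⟨i, ⟨a, b, c⟩, d⟩
    have := entry_inj σ i m a (by omega) h1 h2 d
    subst this
    exact ⟨b, c⟩
  · rintro ⟨a, b⟩
    exact ⟨m, ⟨h1, a, b⟩, rfl⟩

theorem mem_Desbot {n : ℕ} (σ : Equiv.Perm (Fin n)) (m : ℕ) (h2 : m + 1 ≤ n) :
    entry σ (m + 1) ∈ Desbot σ ↔ 1 ≤ m ∧ entry σ (m + 1) < entry σ m := by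
  simp only [Desbot, Finset.mem_image, mem_Des]
  constructor
  · rintro ⟨i, ⟨a, b, c⟩, d⟩
    have := entry_inj σ (i + 1) (m + 1) (by omega) (by omega) (by omega) h2 d
    have : i = m := by omega
    subst this
    exact ⟨a, c⟩
  · rintro ⟨a, b⟩
    exact ⟨m, ⟨a, h2, b⟩, rfl⟩

theorem Destop_filter_card {n : ℕ} (σ : Equiv.Perm (Fin n)) (P : ℕ → Prop) [DecidablePred P] :
    ((Destop σ).filter P).card = ((Des σ).filter (fun i => P (entry σ i))).card := by
  rw [Destop, Finset.filter_image, Finset.card_image_of_injOn]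
  intro i hi j hj h
  simp only [Finset.coe_filter, Set.mem_ofPred_eq, mem_Des] at hi hj
  exact entry_inj σ i j (by omega) (by omega) (by omega) (by omega) h

theorem Desbot_filter_card {n : ℕ} (σ : Equiv.Perm (Fin n)) (P : ℕ → Prop) [DecidablePred P] :
    ((Desbot σ).filter P).card = ((Des σ).filter (fun i => P (entry σ (i + 1)))).card := by
  rw [Desbot, Finset.filter_image, Finset.card_image_of_injOn]
  intro i hi j hj h
  simp only [Finset.coe_filter, Set.mem_ofPred_eq, mem_Des] at hi hj
  have := entry_inj σ (i+1) (j+1) (by omega) (by omega) (by omega) (by omega) h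
  omega

theorem occ2_eq {n : ℕ} (σ : Equiv.Perm (Fin n)) (m : ℕ) (h1 : 1 ≤ m) (h2 : m ≤ n) :
    occ2_31at σ (entry σ m) = ((Des σ).filter
      (fun i => (entry σ (i + 1) < entry σ m ∧ entry σ m < entry σ i) ∧ m < i)).card := by
  symm
  unfold occ2_31at
  apply Finset.card_bij (fun i _ => (m, i))
  · intro i hi
    simp only [Finset.mem_filter, mem_Des, Finset.mem_product, Finset.mem_Icc] at hi ⊢
    grind
  · intro i _ j _ h
    simpa using h
  · rintro ⟨x, y⟩ h
    simp only [Finset.mem_filter, mem_Des, Finset.mem_product, Finset.mem_Icc] at h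
    have := entry_inj σ x m (by omega) (by omega) h1 h2 h.2.2.2.2.1
    subst this
    refine ⟨y, ?_, rfl⟩
    simp only [Finset.mem_filter, mem_Des]
    grind

theorem occ31_eq {n : ℕ} (σ : Equiv.Perm (Fin n)) (m : ℕ) (h1 : 1 ≤ m) (h2 : m ≤ n) :
    occ31_2at σ (entry σ m) = ((Des σ).filter
      (fun i => (entry σ (i + 1) < entry σ m ∧ entry σ m < entry σ i) ∧ ¬ m < i)).card := by
  symm
  unfold occ31_2at
  apply Finset.card_bij (fun i _ => (i, m))
  · intro i hi
    simp only [Finset.mem_filter, mem_Des, Finset.mem_product, Finset.mem_Icc] at hi ⊢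
    have : i ≠ m := by rintro rfl; omega
    have : i + 1 ≠ m := by rintro rfl; omega
    grind
  · intro i _ j _ h
    simpa using h
  · rintro ⟨y, x⟩ h
    simp only [Finset.mem_filter, mem_Des, Finset.mem_product, Finset.mem_Icc] at h
    have := entry_inj σ x m (by omega) (by omega) h1 h2 h.2.2.2.2.1
    subst this
    refine ⟨y, ?_, rfl⟩
    simp only [Finset.mem_filter, mem_Des]
    grind

theorem occ_add {n : ℕ} (σ : Equiv.Perm (Fin n)) (v : ℕ) (h1 : 1 ≤ v) (h2 : v ≤ n) :
    occ2_31at σ v + occ31_2at σ v + ((Destop σ).filter (fun t => t ≤ v)).card =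
      ((Desbot σ).filter (fun t => t < v)).card := by
  obtain ⟨m, h3, h4, rfl⟩ := entry_surj σ v h1 h2
  rw [occ2_eq σ m h3 h4, occ31_eq σ m h3 h4, Destop_filter_card, Desbot_filter_card]
  have e := Finset.card_filter_add_card_filter_not (s := (Des σ).filter
    (fun i => entry σ (i + 1) < entry σ m ∧ entry σ m < entry σ i)) (fun i => m < i)
  rw [Finset.filter_filter, Finset.filter_filter] at e
  rw [e, ← Finset.card_union_of_disjoint]
  · congr 1
    ext i
    simp only [Finset.mem_union, Finset.mem_filter, mem_Des]
    grind
  · rw [Finset.disjoint_filter]; intro i _ h; omega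

/-- the word of `σ` -/
def word {n : ℕ} (σ : Equiv.Perm (Fin n)) : List ℕ :=
  (List.range' 1 n).map (entry σ) ++ [n + 1]

theorem fC_range (e : ℕ → ℕ) (j N : ℕ) (hN : j < N) (s k : ℕ) (b : Bool) :
    fC j b ((List.range' s k).map e ++ [N]) = (if b = true ∧ 0 < k ∧ e s < j then 1 else 0) +
      ((Finset.Ico s (s + k - 1)).filter (fun i => e (i + 1) < j ∧ j < e i)).card := by
  induction k generalizing s b with
  | zero => simp [fC, not_lt.2 hN.le]
  | succ k ih =>
    rw [List.range'_succ, List.map_cons, List.cons_append, fC, ih]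
    simp only [decide_eq_true_eq, Nat.succ_pos, true_and]
    rw [add_assoc]
    congr 1
    rcases Nat.eq_zero_or_pos k with rfl | hk
    · simp
    · have : Finset.Ico s (s + (k + 1) - 1) = insert s (Finset.Ico (s + 1) (s + (1 + k) - 1)) := by
        ext x; simp; omega
      rw [this, Finset.filter_insert]
      split_ifs with h h' h'
      · rw [Finset.card_insert_of_notMem (by simp)]; omega
      · tauto
      · tauto
      · rw [zero_add]

theorem word_split {n : ℕ} (σ : Equiv.Perm (Fin n)) (m : ℕ) (h1 : m + 1 ≤ n) :
    word σ = (List.range' 1 m).map (entry σ) ++ entry σ (m + 1) ::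
      ((List.range' (m + 2) (n - m - 1)).map (entry σ) ++ [n + 1]) := by
  have : List.range' 1 n = List.range' 1 m ++ (m + 1) :: List.range' (m + 2) (n - m - 1) := by
    have e : (m + 1) :: List.range' (m + 2) (n - m - 1) = List.range' (1 + m) (n - m) := by
      rw [show n - m = (n - m - 1) + 1 by omega, List.range'_succ, add_comm 1 m]
      simp
    rw [e, List.range'_append_1]
    congr 1; omega
  rw [word, this]; simp

theorem word_good {n : ℕ} (σ : Equiv.Perm (Fin n)) :
    Good (n + 1) (Destop σ) (Desbot σ) (occ2_31at σ) n (word σ) := by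
  have hU : ∀ m, m + 1 ≤ n → entry σ (m + 1) ∉ (List.range' 1 m).map (entry σ) := by
    intro m hm h
    simp only [List.mem_map, List.mem_range'_1] at h
    obtain ⟨i, hi, h⟩ := h
    have := entry_inj σ _ _ (by omega) (by omega) (by omega) (by omega) h
    omega
  have hV : ∀ m, m + 1 ≤ n → entry σ (m + 1) ∉
      (List.range' (m + 2) (n - m - 1)).map (entry σ) ++ [n + 1] := by
    intro m hm h
    simp only [List.mem_map, List.mem_range'_1, List.mem_append, List.mem_singleton] at h
    rcases h with ⟨i, hi, h⟩ | h
    · have := entry_inj σ _ _ (by omega) (by omega) (by omega) (by omega) h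
      omega
    · have := entry_le σ (m + 1) (by omega) hm
      omega
  have hmem : ∀ x ∈ (List.range' 1 n).map (entry σ), 1 ≤ x ∧ x ≤ n := by
    intro x hx
    simp only [List.mem_map, List.mem_range'_1] at hx
    obtain ⟨i, hi, rfl⟩ := hx
    exact ⟨entry_pos σ i (by omega) (by omega), entry_le σ i (by omega) (by omega)⟩
  refine ⟨?_, ?_, ⟨_, rfl⟩, ?_, ?_, ?_⟩
  · intro j h1 h2
    obtain ⟨m, h3, h4, rfl⟩ := entry_surj σ j h1 h2
    obtain ⟨m, rfl⟩ := Nat.exists_eq_add_of_le' h3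
    rw [word_split σ m h4, List.count_append, List.count_cons_self,
      List.count_eq_zero_of_not_mem (hU m h4), List.count_eq_zero_of_not_mem (hV m h4)]
  · intro x hx
    rw [word, List.mem_append] at hx
    rcases hx with h | h
    · exact Or.inr (hmem x h)
    · left; simpa using h
  · have key : ∀ L : List ℕ, (∀ x ∈ L, 1 ≤ x ∧ x ≤ n) → NN (n + 1) (L ++ [n + 1]) := by
      intro L
      induction L with
      | nil => intro _; simp [NN]
      | cons x L ih =>
        intro h
        rw [List.cons_append, NN_cons]
        refine ⟨ih (fun y hy => h y (by simp [hy])), ?_⟩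
        have := h x (by simp)
        rintro ⟨h, -⟩; omega
    exact key _ hmem
  · have h0 : (word σ).count (n + 1) = 1 := by
      rw [word, List.count_append, List.count_eq_zero_of_not_mem]
      · simp
      · intro h; have := hmem _ h; omega
    rw [h0, Destop_filter_card, Desbot_filter_card, Finset.filter_true_of_mem,
      Finset.filter_true_of_mem, add_comm]
    · intro i hi
      rw [mem_Des] at hi
      exact entry_le σ _ (by omega) (by omega)
    · intro i hi
      rw [mem_Des] at hi
      exact entry_le σ _ (by omega) (by omega)
  · intro j h1 h2
    obtain ⟨m, h3, h4, rfl⟩ := entry_surj σ j h1 h2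
    obtain ⟨m, rfl⟩ := Nat.exists_eq_add_of_le' h3
    have hle := entry_le σ (m + 1) h3 h4
    rw [word_split σ m h4]
    refine ⟨?_, ?_, ?_⟩
    · rw [fB_eval _ _ _ (hU m h4)]
      simp only [mem_Desbot σ m h4]
      rcases m with _ | m
      · simp
      · rw [List.range'_1_concat]
        simp [add_comm 1 m]
    · rw [fT_eval _ _ _ (hU m h4) (hV m h4)]
      simp only [mem_Destop σ (m + 1) h3 h4]
      by_cases h : m + 2 ≤ n
      · obtain ⟨k, hk⟩ : ∃ k, n - m - 1 = k + 1 := ⟨n - m - 2, by omega⟩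
        rw [hk, List.range'_succ]
        have h6 : m + 1 + 1 ≤ n := by omega
        simp [h6]
      · have hk : n - m - 1 = 0 := by omega
        rw [hk]
        have h5 : ¬ (n + 1 < entry σ (m + 1)) := by omega
        have h6 : ¬ (m + 1 + 1 ≤ n) := by omega
        simp [h5, h6]
    · rw [fD_eval _ _ _ (hU m h4), fC_range _ _ _ (by omega), occ2_eq σ _ h3 h4]
      simp only [Bool.false_eq_true, false_and, if_false, zero_add]
      congr 1
      ext i
      simp only [Finset.mem_filter, Finset.mem_Ico, mem_Des]
      grind

theorem word_inj {n : ℕ} (σ τ : Equiv.Perm (Fin n)) (h : word σ = word τ) : σ = τ := by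
  have h' := List.append_cancel_right h
  ext i
  have : entry σ (i + 1) = entry τ (i + 1) := by
    have := congrArg (fun l : List ℕ => l[(i : ℕ)]?) h'
    simpa [List.getElem?_range', add_comm] using this
  rw [entry_eq σ _ (by omega) i.2, entry_eq τ _ (by omega) i.2] at this
  simpa using this

theorem word_surj {n : ℕ} (T B : Finset ℕ) (a : ℕ → ℕ) (hc : T.card = B.card)
    (hT : T ⊆ Finset.Icc 1 n) (hB : B ⊆ Finset.Icc 1 n) (W : List ℕ)
    (h : Good (n + 1) T B a n W) : ∃ σ : Equiv.Perm (Fin n), word σ = W := by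
  obtain ⟨L, rfl⟩ := h.last
  have hN := h.cntN
  rw [Finset.filter_true_of_mem (fun t ht => (Finset.mem_Icc.1 (hT ht)).2),
    Finset.filter_true_of_mem (fun t ht => (Finset.mem_Icc.1 (hB ht)).2), List.count_append] at hN
  simp at hN
  have hNL : n + 1 ∉ L := List.count_eq_zero.1 (by omega)
  have hmem : ∀ x ∈ L, 1 ≤ x ∧ x ≤ n := by
    intro x hx
    rcases h.mem x (by simp [hx]) with h | h
    · subst h; exact absurd hx hNL
    · exact h
  have hcnt : ∀ j, 1 ≤ j → j ≤ n → L.count j = 1 := by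
    intro j h1 h2
    have := h.cnt j h1 h2
    rw [List.count_append, List.count_eq_zero_of_not_mem (l := [n+1]) (by simp; omega)] at this
    omega
  have hp : L.Perm (List.range' 1 n) := by
    rw [List.perm_iff_count]
    intro j
    by_cases hj : 1 ≤ j ∧ j ≤ n
    · rw [hcnt j hj.1 hj.2, List.count_eq_one_of_mem List.nodup_range']
      simp; omega
    · rw [List.count_eq_zero_of_not_mem, List.count_eq_zero_of_not_mem]
      · simp; omega
      · exact fun h => hj (hmem j h)
  have hlen : L.length = n := by simpa using hp.length_eq
  have hnd : L.Nodup := hp.nodup_iff.2 List.nodup_range'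
  have hm' : ∀ i : Fin n, 1 ≤ L[(i:ℕ)]'(by omega) ∧ L[(i:ℕ)]'(by omega) ≤ n :=
    fun i => hmem _ (List.getElem_mem _)
  let f : Fin n → Fin n := fun i => ⟨L[(i:ℕ)]'(by omega) - 1, by have := hm' i; omega⟩
  have hf : Function.Injective f := by
    intro i j hij
    simp only [f, Fin.mk.injEq] at hij
    have := hm' i
    have := hm' j
    have : L[(i:ℕ)]'(by omega) = L[(j:ℕ)]'(by omega) := by omega
    exact Fin.ext ((hnd.getElem_inj_iff).1 this)
  refine ⟨Equiv.ofBijective f (Finite.injective_iff_bijective.1 hf), ?_⟩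
  rw [word]
  congr 1
  apply List.ext_getElem
  · simp [hlen]
  · intro i h1 h2
    rw [List.getElem_map, entry_eq _ _ (by simp) (by simp; omega)]
    simp [f]
    have := hmem _ (List.getElem_mem h2)
    omega

theorem Good.congr {N : ℕ} {T B : Finset ℕ} {a a' : ℕ → ℕ} {v : ℕ} {W : List ℕ}
    (h : Good N T B a v W) (ha : ∀ j, 1 ≤ j → j ≤ v → a j = a' j) : Good N T B a' v W :=
  ⟨h.cnt, h.mem, h.last, h.nn, h.cntN, fun j h1 h2 => by
    have := h.st j h1 h2
    unfold St at this ⊢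
    rwa [ha j h1 h2] at this⟩

theorem match_fun (T B : Finset ℕ) (h : DescentMatching T B) : ∃ f : ℕ → ℕ,
    Set.InjOn f T ∧ ∀ t ∈ T, f t ∈ B ∧ f t < t := by
  obtain ⟨hc, -, -, h⟩ := h
  have hidx : ∀ t ∈ T, (T.sort (· ≤ ·)).idxOf t < T.card := by
    intro t ht
    have := List.idxOf_lt_length_of_mem ((Finset.mem_sort (· ≤ ·)).2 ht)
    simpa using this
  refine ⟨fun t => (B.sort (· ≤ ·)).getD ((T.sort (· ≤ ·)).idxOf t) 0, ?_, ?_⟩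
  · intro t ht s hs hts
    have h1 := hidx t ht
    have h2 := hidx s hs
    simp only at hts
    rw [List.getD_eq_getElem _ _ (by simpa [← hc] using h1),
      List.getD_eq_getElem _ _ (by simpa [← hc] using h2)] at hts
    have := ((Finset.sort_nodup B (· ≤ ·)).getElem_inj_iff).1 hts
    exact (List.idxOf_inj ((Finset.mem_sort (· ≤ ·)).2 ht)).1 this
  · intro t ht
    have h1 := hidx t ht
    have h2 := h _ h1
    constructor
    · simp only
      rw [List.getD_eq_getElem _ _ (by simpa [← hc] using h1)]
      exact (Finset.mem_sort (· ≤ ·)).1 (List.getElem_mem _)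
    · rw [List.getD_eq_getElem (T.sort (· ≤ ·)) _ (by simpa using h1), List.getElem_idxOf] at h2
      exact h2

end DT

theorem occ_at_generating_function_prod {R : Type*} [CommRing R] (n : ℕ) (T B : Finset ℕ)
    (hTB : DescentMatching T B) (hT : T ⊆ Finset.Icc 1 n) (p q : ℕ → R) :
    ∑ σ ∈ (Finset.univ : Finset (Equiv.Perm (Fin n))).filter
        (fun σ => Destop σ = T ∧ Desbot σ = B),
      ∏ i ∈ Finset.Icc 1 n, p i ^ occ2_31at σ i * q i ^ occ31_2at σ i =
    ∏ i ∈ Finset.Icc 1 n, genQInt (sg T B i) (p i) (q i) := by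
  obtain ⟨f, hf, hfB⟩ := DT.match_fun T B hTB
  have hle : ∀ i, (T.filter (fun t => t ≤ i)).card ≤ (B.filter (fun b => b < i)).card := by
    intro i
    apply Finset.card_le_card_of_injOn f
    · intro t ht
      simp only [Finset.coe_filter, Set.mem_ofPred_eq] at ht ⊢
      have := hfB t ht.1
      exact ⟨this.1, by omega⟩
    · exact hf.mono (by intro t; simp; tauto)
  have hT0 : ∀ t ∈ T, 0 < t := hTB.2.1
  have hB0 : ∀ t ∈ B, 0 < t := hTB.2.2.1
  have hB : B ⊆ Finset.Icc 1 n := by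
    have : T.image f = B := by
      apply Finset.eq_of_subset_of_card_le
      · intro b hb
        obtain ⟨t, ht, rfl⟩ := Finset.mem_image.1 hb
        exact (hfB t ht).1
      · rw [Finset.card_image_of_injOn hf, hTB.1]
    intro b hb
    have hb0 := hB0 b hb
    rw [← this] at hb
    obtain ⟨t, ht, rfl⟩ := Finset.mem_image.1 hb
    have := hfB t ht
    have := Finset.mem_Icc.1 (hT ht)
    rw [Finset.mem_Icc]; omega
  unfold genQInt
  rw [Finset.prod_sum]
  apply Finset.sum_bij (fun σ _ => fun i _ => occ2_31at σ i)
  · intro σ hσ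
    simp only [Finset.mem_filter, Finset.mem_univ, true_and] at hσ
    simp only [Finset.mem_pi, Finset.mem_range]
    intro i hi
    rw [Finset.mem_Icc] at hi
    have := DT.occ_add σ i hi.1 hi.2
    rw [hσ.1, hσ.2] at this
    unfold sg
    omega
  · intro σ hσ τ hτ h
    simp only [Finset.mem_filter, Finset.mem_univ, true_and] at hσ hτ
    have h1 := DT.word_good σ
    have h2 := DT.word_good τ
    rw [hσ.1, hσ.2] at h1
    rw [hτ.1, hτ.2] at h2
    apply DT.word_inj
    refine DT.good_unique (n + 1) T B (occ2_31at τ) n (by omega) _ _ hT0 hB0 (h1.congr ?_) h2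
    intro j hj1 hj2
    exact congrFun (congrFun h j) (Finset.mem_Icc.2 ⟨hj1, hj2⟩)
  · intro a ha
    simp only [Finset.mem_pi, Finset.mem_range] at ha
    let a' : ℕ → ℕ := fun j => if h : j ∈ Finset.Icc 1 n then a j h else 0
    obtain ⟨W, hW⟩ := DT.good_exists (n + 1) T B a' n (by omega) hT0 hB0 (by
      intro j h1 h2
      have hj := Finset.mem_Icc.2 ⟨h1, h2⟩
      have := ha j hj
      have e : a' j = a j hj := dif_pos hj
      have := hle j
      unfold sg at *
      omega)
    obtain ⟨σ, rfl⟩ := DT.word_surj T B a' hTB.1 hT hB W hW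
    have hg := DT.word_good σ
    have hTs : Destop σ ⊆ Finset.Icc 1 n := by
      intro x hx
      obtain ⟨i, hi, rfl⟩ := Finset.mem_image.1 hx
      rw [DT.mem_Des] at hi
      exact Finset.mem_Icc.2 ⟨DT.entry_pos σ _ (by omega) (by omega),
        DT.entry_le σ _ (by omega) (by omega)⟩
    have hBs : Desbot σ ⊆ Finset.Icc 1 n := by
      intro x hx
      obtain ⟨i, hi, rfl⟩ := Finset.mem_image.1 hx
      rw [DT.mem_Des] at hi
      exact Finset.mem_Icc.2 ⟨DT.entry_pos σ _ (by omega) (by omega),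
        DT.entry_le σ _ (by omega) (by omega)⟩
    have key : ∀ j ∈ Finset.Icc 1 n, (j ∈ Desbot σ ↔ j ∈ B) ∧ (j ∈ Destop σ ↔ j ∈ T) ∧
        occ2_31at σ j = a' j := by
      intro j hj
      rw [Finset.mem_Icc] at hj
      obtain ⟨x1, x2, x3⟩ := hg.st j hj.1 hj.2
      obtain ⟨y1, y2, y3⟩ := hW.st j hj.1 hj.2
      rw [x1] at y1
      rw [x2] at y2
      exact ⟨by simpa using y1, by simpa using y2, by omega⟩
    refine ⟨σ, ?_, ?_⟩
    · simp only [Finset.mem_filter, Finset.mem_univ, true_and]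
      constructor
      · ext j
        exact ⟨fun h => (key j (hTs h)).2.1.1 h, fun h => (key j (hT h)).2.1.2 h⟩
      · ext j
        exact ⟨fun h => (key j (hBs h)).1.1 h, fun h => (key j (hB h)).1.2 h⟩
    · funext j hj
      rw [(key j hj).2.2]
      exact dif_pos hj
  · intro σ hσ
    simp only [Finset.mem_filter, Finset.mem_univ, true_and] at hσ
    rw [← Finset.prod_attach]
    apply Finset.prod_congr rfl
    rintro ⟨i, hi⟩ -
    rw [Finset.mem_Icc] at hi
    have := DT.occ_add σ i hi.1 hi.2
    rw [hσ.1, hσ.2] at this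
    simp only
    congr 2
    unfold sg
    omega
end
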